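/- arXiv:2411.06013 — 3 statements merged into one kernel-verified Lean document; each statement's English description precedes it below -/
import Mathlib

section
/- Let d ≥ 2 and let μ_O denote the Haar probability measure on O(d). For all complex d×d matrices A, B, M₁, M₂, one has ∫_{O(d)} tr(O·A·Oᵀ·M₁)·tr(O·B·Oᵀ·M₂) dμ_O(O) = c₁·tr(A)tr(B) + c₂·tr(A·B) + c₃·tr(A·Bᵀ), where c₁ = ((d+1)tr(M₁)tr(M₂) − tr(M₁M₂) − tr(M₁M₂ᵀ)) / (d(d−1)(d+2)), c₂ = (−tr(M₁)tr(M₂) + (d+1)tr(M₁M₂) − tr(M₁M₂ᵀ)) / (d(d−1)(d+2)), and c₃ = (−tr(M₁)tr(M₂) − tr(M₁M₂) + (d+1)tr(M₁M₂ᵀ)) / (d(d−1)(d+2)). -/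
open MeasureTheory Matrix

/-- Entrywise coercion of a real orthogonal matrix to a complex matrix. -/
def OC {d : ℕ} (O : Matrix.orthogonalGroup (Fin d) ℝ) : Matrix (Fin d) (Fin d) ℂ :=
  (O : Matrix (Fin d) (Fin d) ℝ).map Complex.ofReal

open Finset

/-- A 4-tensor is orthogonally invariant if applying the same orthogonal matrix to each of
its indices leaves it unchanged. -/
def IsOrthogonallyInvariant {n : Type*} [Fintype n] [DecidableEq n] (t : n → n → n → n → ℝ) :
    Prop :=
  ∀ R ∈ orthogonalGroup n ℝ, ∀ i j k l,
    t i j k l = ∑ p, R i p * ∑ q, R j q * ∑ r, R k r * ∑ s, R l s * t p q r s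

namespace IsOrthogonallyInvariant

variable {n : Type*} [Fintype n] [DecidableEq n] {t : n → n → n → n → ℝ}

lemma apply_perm (ht : IsOrthogonallyInvariant t) (σ : Equiv.Perm n) (i j k l : n) :
    t (σ i) (σ j) (σ k) (σ l) = t i j k l := by
  have hR : (Matrix.of fun p q => if q = σ p then (1 : ℝ) else 0) ∈ orthogonalGroup n ℝ := by
    rw [mem_orthogonalGroup_iff]
    ext p q
    simp [mul_apply, one_apply, eq_comm]
  have h := ht _ hR i j k l
  simpa using h.symm

lemma apply_sign (ht : IsOrthogonallyInvariant t) {s : n → ℝ} (hs : ∀ i, s i * s i = 1)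
    (i j k l : n) : t i j k l = s i * (s j * (s k * (s l * t i j k l))) := by
  have hR : Matrix.diagonal s ∈ orthogonalGroup n ℝ := by
    rw [mem_orthogonalGroup_iff]
    simp [hs]
  have h := ht _ hR i j k l
  simpa [diagonal_apply] using h

/-- An invariant tensor vanishes if some index value occurs an odd number of times. -/
lemma eq_zero_of_odd (ht : IsOrthogonallyInvariant t) (m : n) {i j k l : n}
    (h : (if i = m then (-1 : ℝ) else 1) * (if j = m then -1 else 1) *
      (if k = m then -1 else 1) * (if l = m then -1 else 1) = -1) : t i j k l = 0 := by
  have hs := ht.apply_sign (s := fun p => if p = m then -1 else 1)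
    (fun p => by split_ifs <;> norm_num) i j k l
  simp only [← mul_assoc, h] at hs
  linarith

lemma apply_diag (ht : IsOrthogonallyInvariant t) {a c : n} (hac : a ≠ c) :
    t a a a a = t a a c c + t a c a c + t a c c a := by
  let R : Matrix n n ℝ := Matrix.of fun p q =>
    if p = a then (if q = a then 3 / 5 else if q = c then 4 / 5 else 0)
    else if p = c then (if q = a then 4 / 5 else if q = c then -3 / 5 else 0)
    else if q = p then 1 else 0
  have sum_pair (x y : ℝ) (f : n → ℝ) :
      ∑ q, (if q = a then x else if q = c then y else 0) * f q = x * f a + y * f c := by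
    have : ∀ q, (if q = a then x else if q = c then y else 0) * f q =
        (if q = a then x * f q else 0) + (if q = c then y * f q else 0) := by
      intro q; split_ifs <;> simp_all
    simp [this, sum_add_distrib]
  have hR : R ∈ orthogonalGroup n ℝ := by
    rw [mem_orthogonalGroup_iff]
    ext p q
    simp only [mul_apply, R, transpose_apply, of_apply, one_apply]
    by_cases hpa : p = a
    · subst hpa
      simp only [if_true, sum_pair]
      grind
    by_cases hpc : p = c
    · subst hpc
      simp only [if_true, if_neg hpa, sum_pair]
      grind
    · simp only [if_neg hpa, if_neg hpc, ite_mul, one_mul, zero_mul, sum_ite_eq', mem_univ, if_true]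
      grind
  have h := ht R hR a a a a
  simp only [R, of_apply, if_true, sum_pair] at h
  have hca := hac.symm
  have hcccc : t c c c c = t a a a a := by
    simpa using ht.apply_perm (Equiv.swap a c) a a a a
  have h1 : t c c a a = t a a c c := by
    simpa using ht.apply_perm (Equiv.swap a c) a a c c
  have h2 : t c a c a = t a c a c := by
    simpa using ht.apply_perm (Equiv.swap a c) a c a c
  have h3 : t c a a c = t a c c a := by
    simpa using ht.apply_perm (Equiv.swap a c) a c c a
  have z : t a a a c = 0 ∧ t a a c a = 0 ∧ t a c a a = 0 ∧ t c a a a = 0 ∧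
      t c c c a = 0 ∧ t c c a c = 0 ∧ t c a c c = 0 ∧ t a c c c = 0 := by
    refine ⟨?_, ?_, ?_, ?_, ?_, ?_, ?_, ?_⟩ <;> apply ht.eq_zero_of_odd a <;> simp [hca]
  obtain ⟨z1, z2, z3, z4, z5, z6, z7, z8⟩ := z
  rw [hcccc, h1, h2, h3, z1, z2, z3, z4, z5, z6, z7, z8] at h
  linarith

/-- Orthogonally invariant 4-tensors are spanned by the three pairings. -/
lemma exists_pairings [Nontrivial n] (ht : IsOrthogonallyInvariant t) :
    ∃ α β γ : ℝ, ∀ i j k l, t i j k l =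
      α * ((1 : Matrix n n ℝ) i j * (1 : Matrix n n ℝ) k l) +
      β * ((1 : Matrix n n ℝ) i k * (1 : Matrix n n ℝ) j l) +
      γ * ((1 : Matrix n n ℝ) i l * (1 : Matrix n n ℝ) j k) := by
  obtain ⟨a, c, hac⟩ := exists_pair_ne n
  have hperm {i j : n} (hij : i ≠ j) : ∃ σ : Equiv.Perm n, σ a = i ∧ σ c = j :=
    (MulAction.is_two_pretransitive_iff.mp
      (Equiv.Perm.isMultiplyPretransitive n 2)) hac hij
  have h1 {i j : n} (hij : i ≠ j) : t i i j j = t a a c c := by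
    obtain ⟨σ, rfl, rfl⟩ := hperm hij
    exact ht.apply_perm ..
  have h2 {i j : n} (hij : i ≠ j) : t i j i j = t a c a c := by
    obtain ⟨σ, rfl, rfl⟩ := hperm hij
    exact ht.apply_perm ..
  have h3 {i j : n} (hij : i ≠ j) : t i j j i = t a c c a := by
    obtain ⟨σ, rfl, rfl⟩ := hperm hij
    exact ht.apply_perm ..
  have h4 (i : n) : t i i i i = t a a c c + t a c a c + t a c c a := by
    obtain ⟨j, hij⟩ := exists_ne i
    rw [ht.apply_diag hij.symm, h1 hij.symm, h2 hij.symm, h3 hij.symm]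
  refine ⟨t a a c c, t a c a c, t a c c a, fun i j k l => ?_⟩
  by_cases hij : i = j
  · subst hij
    by_cases hkl : k = l
    · subst hkl
      by_cases hik : i = k
      · subst hik; simp [h4]
      · simp [h1 hik, one_apply, hik]
    · rw [ht.eq_zero_of_odd k]
      · simp only [one_apply]; grind
      · by_cases i = k <;> simp [*, Ne.symm hkl]
  by_cases hik : i = k
  · subst hik
    by_cases hjl : j = l
    · subst hjl; simp [h2 hij, one_apply, hij]
    · rw [ht.eq_zero_of_odd j]
      · simp only [one_apply]; grind
      · simp [hij, Ne.symm hjl]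
  by_cases hil : i = l
  · subst hil
    by_cases hjk : j = k
    · subst hjk; simp [h3 hij, one_apply, hij]
    · rw [ht.eq_zero_of_odd j]
      · simp only [one_apply]; grind
      · simp [hij, Ne.symm hjk]
  rw [ht.eq_zero_of_odd i]
  · simp [one_apply, hij, hik, hil]
  · simp [Ne.symm hij, Ne.symm hik, Ne.symm hil]

end IsOrthogonallyInvariant

/-- Contracting two matrices against a combination of the three pairings. -/
lemma sum_mul_pairings {n R : Type*} [Fintype n] [DecidableEq n] [CommRing R]
    (A B : Matrix n n R) (x y z : R) :
    ∑ i, ∑ j, ∑ k, ∑ l, A i j * B k l *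
      (x * ((1 : Matrix n n R) i j * (1 : Matrix n n R) k l) +
       y * ((1 : Matrix n n R) i k * (1 : Matrix n n R) j l) +
       z * ((1 : Matrix n n R) i l * (1 : Matrix n n R) j k)) =
      x * (A.trace * B.trace) + y * (A * Bᵀ).trace + z * (A * B).trace := by
  have h1 : ∑ i, ∑ j, ∑ k, ∑ l, A i j * B k l *
      ((1 : Matrix n n R) i j * (1 : Matrix n n R) k l) = A.trace * B.trace := by
    simp [one_apply, trace, sum_mul_sum]
  have h2 : ∑ i, ∑ j, ∑ k, ∑ l, A i j * B k l *
      ((1 : Matrix n n R) i k * (1 : Matrix n n R) j l) = (A * Bᵀ).trace := by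
    simp [one_apply, trace, mul_apply]
  have h3 : ∑ i, ∑ j, ∑ k, ∑ l, A i j * B k l *
      ((1 : Matrix n n R) i l * (1 : Matrix n n R) j k) = (A * B).trace := by
    simp [one_apply, trace, mul_apply]
  rw [← h1, ← h2, ← h3]
  simp only [mul_sum, ← sum_add_distrib]
  refine sum_congr rfl fun i _ => sum_congr rfl fun j _ => sum_congr rfl fun k _ =>
    sum_congr rfl fun l _ => ?_
  ring

section FourfoldSum

variable {n Ω E : Type*} [Fintype n] [MeasurableSpace Ω] {μ : Measure Ω}
  [NormedAddCommGroup E] {F : n → n → n → n → Ω → E}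

lemma integrable_sum₄ (hF : ∀ i j k l, Integrable (F i j k l) μ) :
    Integrable (fun x => ∑ i, ∑ j, ∑ k, ∑ l, F i j k l x) μ :=
  integrable_finsetSum _ fun i _ => integrable_finsetSum _ fun j _ =>
    integrable_finsetSum _ fun k _ => integrable_finsetSum _ fun l _ => hF i j k l

lemma integral_sum₄ [NormedSpace ℝ E] (hF : ∀ i j k l, Integrable (F i j k l) μ) :
    ∫ x, ∑ i, ∑ j, ∑ k, ∑ l, F i j k l x ∂μ = ∑ i, ∑ j, ∑ k, ∑ l, ∫ x, F i j k l x ∂μ := by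
  rw [integral_finsetSum _ fun i _ => integrable_finsetSum _ fun j _ =>
    integrable_finsetSum _ fun k _ => integrable_finsetSum _ fun l _ => hF i j k l]
  refine sum_congr rfl fun i _ => ?_
  rw [integral_finsetSum _ fun j _ => integrable_finsetSum _ fun k _ =>
    integrable_finsetSum _ fun l _ => hF i j k l]
  refine sum_congr rfl fun j _ => ?_
  rw [integral_finsetSum _ fun k _ => integrable_finsetSum _ fun l _ => hF i j k l]
  exact sum_congr rfl fun k _ => integral_finsetSum _ fun l _ => hF i j k l

end FourfoldSum

section Haar

variable {n : Type*} [Fintype n] [DecidableEq n]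

instance compactSpace_orthogonalGroup : CompactSpace (orthogonalGroup n ℝ) := by
  refine isCompact_iff_compactSpace.mp (?_ : IsCompact {A | A ∈ orthogonalGroup n ℝ})
  refine IsCompact.of_isClosed_subset (isCompact_univ_pi fun _ : n => isCompact_univ_pi
    fun _ : n => isCompact_Icc (a := (-1 : ℝ)) (b := 1)) ?_ ?_
  · simp only [mem_orthogonalGroup_iff]
    exact isClosed_eq (by fun_prop) continuous_const
  · intro A hA i _ j _
    exact abs_le.mp (entry_norm_bound_of_unitary hA i j)

variable [MeasurableSpace (orthogonalGroup n ℝ)] [BorelSpace (orthogonalGroup n ℝ)]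
  (μ : Measure (orthogonalGroup n ℝ))

lemma integrable_entries [IsFiniteMeasure μ] (a b c e i j k l : n) :
    Integrable (fun O : orthogonalGroup n ℝ => O.1 i a * O.1 j b * O.1 k c * O.1 l e) μ := by
  have : Continuous fun O : orthogonalGroup n ℝ => O.1 i a * O.1 j b * O.1 k c * O.1 l e := by
    have h (i j : n) : Continuous fun O : orthogonalGroup n ℝ => O.1 i j :=
      continuous_subtype_val.matrix_elem i j
    exact (((h i a).mul (h j b)).mul (h k c)).mul (h l e)
  exact this.integrable_of_hasCompactSupport (HasCompactSupport.of_compactSpace _)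

lemma isOrthogonallyInvariant_integral [IsFiniteMeasure μ] [μ.IsMulLeftInvariant] (a b c e : n) :
    IsOrthogonallyInvariant fun i j k l =>
      ∫ O, O.1 i a * O.1 j b * O.1 k c * O.1 l e ∂μ := by
  intro R hR i j k l
  have h := integral_mul_left_eq_self (μ := μ)
    (fun O : orthogonalGroup n ℝ => O.1 i a * O.1 j b * O.1 k c * O.1 l e) ⟨R, hR⟩
  simp only [← h, mul_sum, ← integral_const_mul]
  rw [← integral_sum₄ fun p q r s => ((((integrable_entries μ a b c e p q r s).const_mul
    _).const_mul _).const_mul _).const_mul _]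
  refine integral_congr_ae (.of_forall fun O => ?_)
  have hrev (x y z w : ℝ) : x * y * z * w = w * z * y * x := by ring
  refine (hrev _ _ _ _).trans ?_
  simp only [UnitaryGroup.mul_val, Matrix.mul_apply, sum_mul, mul_sum]
  refine sum_congr rfl fun p _ => sum_congr rfl fun q _ => sum_congr rfl fun r _ =>
    sum_congr rfl fun s _ => ?_
  ring

/-- The fourth moments of the entries of a Haar-distributed orthogonal matrix. -/
lemma integral_entries [Nontrivial n] [IsProbabilityMeasure μ] [μ.IsMulLeftInvariant]
    (a b c e i j k l : n) :
    (Fintype.card n * (Fintype.card n - 1) * (Fintype.card n + 2) : ℝ) *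
      ∫ O, O.1 i a * O.1 j b * O.1 k c * O.1 l e ∂μ =
    let δ : n → n → ℝ := (1 : Matrix n n ℝ)
    ((Fintype.card n + 1) * (δ a b * δ c e) - δ a c * δ b e - δ a e * δ b c) * (δ i j * δ k l) +
    ((Fintype.card n + 1) * (δ a c * δ b e) - δ a b * δ c e - δ a e * δ b c) * (δ i k * δ j l) +
    ((Fintype.card n + 1) * (δ a e * δ b c) - δ a b * δ c e - δ a c * δ b e) * (δ i l * δ j k) := by
  obtain ⟨α, β, γ, h⟩ := (isOrthogonallyInvariant_integral μ a b c e).exists_pairings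
  have hcol (O : orthogonalGroup n ℝ) (a b : n) :
      ∑ i, O.1 i a * O.1 i b = (1 : Matrix n n ℝ) a b := by
    rw [← (mem_orthogonalGroup_iff' n ℝ).mp O.2]
    simp [Matrix.mul_apply]
  have hcontract (p q r s : n → n → n) {x : ℝ}
      (hx : ∀ O : orthogonalGroup n ℝ, ∑ i, ∑ k,
        O.1 (p i k) a * O.1 (q i k) b * O.1 (r i k) c * O.1 (s i k) e = x) :
      ∑ i, ∑ k, ∫ O, O.1 (p i k) a * O.1 (q i k) b * O.1 (r i k) c * O.1 (s i k) e ∂μ = x := by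
    have hI := integrable_entries μ a b c e
    simp_rw [← integral_finsetSum univ fun k _ => hI _ _ _ _]
    rw [← integral_finsetSum univ fun i _ => integrable_finsetSum univ fun k _ => hI _ _ _ _]
    simp [hx]
  have e1 := hcontract (fun i _ => i) (fun i _ => i) (fun _ k => k) (fun _ k => k)
    (x := (1 : Matrix n n ℝ) a b * (1 : Matrix n n ℝ) c e) fun O => by
      rw [← hcol O a b, ← hcol O c e, sum_mul_sum]
      exact sum_congr rfl fun i _ => sum_congr rfl fun k _ => by ring
  have e2 := hcontract (fun i _ => i) (fun _ k => k) (fun i _ => i) (fun _ k => k)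
    (x := (1 : Matrix n n ℝ) a c * (1 : Matrix n n ℝ) b e) fun O => by
      rw [← hcol O a c, ← hcol O b e, sum_mul_sum]
      exact sum_congr rfl fun i _ => sum_congr rfl fun k _ => by ring
  have e3 := hcontract (fun i _ => i) (fun _ k => k) (fun _ k => k) (fun i _ => i)
    (x := (1 : Matrix n n ℝ) a e * (1 : Matrix n n ℝ) b c) fun O => by
      rw [← hcol O a e, ← hcol O b c, sum_mul_sum]
      exact sum_congr rfl fun i _ => sum_congr rfl fun k _ => by ring
  simp only [h, one_apply_eq, sum_add_distrib, ← mul_sum] at e1 e2 e3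
  dsimp only
  generalize (1 : Matrix n n ℝ) a b * (1 : Matrix n n ℝ) c e = x at e1 ⊢
  generalize (1 : Matrix n n ℝ) a c * (1 : Matrix n n ℝ) b e = y at e2 ⊢
  generalize (1 : Matrix n n ℝ) a e * (1 : Matrix n n ℝ) b c = z at e3 ⊢
  simp [one_apply] at e1 e2 e3
  rw [h, ← e1, ← e2, ← e3]
  ring

end Haar

lemma sum_mul_sum₂ {n R : Type*} [Fintype n] [CommRing R] (f g : n → n → R) :
    (∑ i, ∑ j, f i j) * ∑ k, ∑ l, g k l = ∑ i, ∑ j, ∑ k, ∑ l, f i j * g k l := by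
  simp only [sum_mul]
  simp only [mul_sum]

lemma trace_conj_mul {n R : Type*} [Fintype n] [CommRing R] (Q A M : Matrix n n R) :
    (Q * A * Qᵀ * M).trace = ∑ i, ∑ j, Mᵀ i j * ∑ a, ∑ b, A a b * (Q i a * Q j b) := by
  simp only [trace, diag_apply, Matrix.mul_apply, transpose_apply, sum_mul, mul_sum]
  refine sum_congr rfl fun i _ => sum_congr rfl fun j _ => ?_
  rw [sum_comm]
  exact sum_congr rfl fun a _ => sum_congr rfl fun b _ => by ring

lemma integral_trace_mul_trace {d : ℕ} [MeasurableSpace (orthogonalGroup (Fin d) ℝ)]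
    [BorelSpace (orthogonalGroup (Fin d) ℝ)] (μ : Measure (orthogonalGroup (Fin d) ℝ))
    [IsFiniteMeasure μ] (A B M₁ M₂ : Matrix (Fin d) (Fin d) ℂ) :
    ∫ O, (OC O * A * (OC O)ᵀ * M₁).trace * (OC O * B * (OC O)ᵀ * M₂).trace ∂μ =
      ∑ i, ∑ j, ∑ k, ∑ l, M₁ᵀ i j * M₂ᵀ k l * ∑ a, ∑ b, ∑ c, ∑ e, A a b * B c e *
        ((∫ O, O.1 i a * O.1 j b * O.1 k c * O.1 l e ∂μ : ℝ) : ℂ) := by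
  have hI (a b c e i j k l : Fin d) : Integrable (fun O : orthogonalGroup (Fin d) ℝ =>
      A a b * B c e * ((O.1 i a * O.1 j b * O.1 k c * O.1 l e : ℝ) : ℂ)) μ :=
    (integrable_entries μ a b c e i j k l).ofReal.const_mul _
  trans ∫ O : orthogonalGroup (Fin d) ℝ, ∑ i, ∑ j, ∑ k, ∑ l, M₁ᵀ i j * M₂ᵀ k l *
    ∑ a, ∑ b, ∑ c, ∑ e, A a b * B c e * ((O.1 i a * O.1 j b * O.1 k c * O.1 l e : ℝ) : ℂ) ∂μ
  · refine integral_congr_ae (.of_forall fun O => ?_)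
    dsimp only
    rw [trace_conj_mul, trace_conj_mul, sum_mul_sum₂]
    refine sum_congr rfl fun i _ => sum_congr rfl fun j _ => sum_congr rfl fun k _ =>
      sum_congr rfl fun l _ => ?_
    rw [mul_mul_mul_comm, sum_mul_sum₂]
    refine congrArg (M₁ᵀ i j * M₂ᵀ k l * ·) ?_
    refine sum_congr rfl fun a _ => sum_congr rfl fun b _ => sum_congr rfl fun c _ =>
      sum_congr rfl fun e _ => ?_
    simp only [OC, map_apply]
    push_cast
    ring
  rw [integral_sum₄ fun i j k l =>
    (integrable_sum₄ fun a b c e => hI a b c e i j k l).const_mul _]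
  refine sum_congr rfl fun i _ => sum_congr rfl fun j _ => sum_congr rfl fun k _ =>
    sum_congr rfl fun l _ => ?_
  rw [integral_const_mul, integral_sum₄ fun a b c e => hI a b c e i j k l]
  simp only [integral_const_mul, integral_complex_ofReal]

/-- second-moment twirl identity for products of two traces. -/
theorem stmt_3 (d : ℕ) (hd : 2 ≤ d)
    [MeasurableSpace (Matrix.orthogonalGroup (Fin d) ℝ)]
    [BorelSpace (Matrix.orthogonalGroup (Fin d) ℝ)]
    (μ : Measure (Matrix.orthogonalGroup (Fin d) ℝ))
    [μ.IsHaarMeasure] [IsProbabilityMeasure μ]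
    (A B M₁ M₂ : Matrix (Fin d) (Fin d) ℂ)
    (c₁ c₂ c₃ : ℂ)
    (hc₁ : c₁ = (((d : ℂ) + 1) * M₁.trace * M₂.trace - (M₁ * M₂).trace - (M₁ * M₂ᵀ).trace) /
      ((d : ℂ) * ((d : ℂ) - 1) * ((d : ℂ) + 2)))
    (hc₂ : c₂ = (-(M₁.trace * M₂.trace) + ((d : ℂ) + 1) * (M₁ * M₂).trace - (M₁ * M₂ᵀ).trace) /
      ((d : ℂ) * ((d : ℂ) - 1) * ((d : ℂ) + 2)))
    (hc₃ : c₃ = (-(M₁.trace * M₂.trace) - (M₁ * M₂).trace + ((d : ℂ) + 1) * (M₁ * M₂ᵀ).trace) /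
      ((d : ℂ) * ((d : ℂ) - 1) * ((d : ℂ) + 2))) :
    ∫ O, (OC O * A * (OC O)ᵀ * M₁).trace * (OC O * B * (OC O)ᵀ * M₂).trace ∂μ =
      c₁ * A.trace * B.trace + c₂ * (A * B).trace + c₃ * (A * Bᵀ).trace := by
  have : Nontrivial (Fin d) := Fin.nontrivial_iff_two_le.mpr hd
  have hD : (d : ℂ) * ((d : ℂ) - 1) * ((d : ℂ) + 2) ≠ 0 := by
    have h0 : (d : ℂ) ≠ 0 := by exact_mod_cast (by omega : d ≠ 0)
    have h1 : (d : ℂ) - 1 ≠ 0 := sub_ne_zero.mpr (by exact_mod_cast (by omega : d ≠ 1))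
    have h2 : (d : ℂ) + 2 ≠ 0 := by exact_mod_cast (by omega : d + 2 ≠ 0)
    exact mul_ne_zero (mul_ne_zero h0 h1) h2
  have hone (i j : Fin d) :
      (((1 : Matrix (Fin d) (Fin d) ℝ) i j : ℝ) : ℂ) = (1 : Matrix (Fin d) (Fin d) ℂ) i j := by
    simp only [Matrix.one_apply]; split_ifs <;> simp
  have key : (d : ℂ) * ((d : ℂ) - 1) * ((d : ℂ) + 2) *
      ∫ O, (OC O * A * (OC O)ᵀ * M₁).trace * (OC O * B * (OC O)ᵀ * M₂).trace ∂μ =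
      ((d + 1) * (A.trace * B.trace) - (A * Bᵀ).trace - (A * B).trace) *
        (M₁.trace * M₂.trace) +
      ((d + 1) * (A * Bᵀ).trace - A.trace * B.trace - (A * B).trace) * (M₁ * M₂ᵀ).trace +
      ((d + 1) * (A * B).trace - A.trace * B.trace - (A * Bᵀ).trace) * (M₁ * M₂).trace := by
    have hM : (M₁ᵀ * M₂ᵀᵀ).trace = (M₁ * M₂ᵀ).trace := by
      rw [← trace_transpose, transpose_mul, transpose_transpose, transpose_transpose, trace_mul_comm]
    have hM' : (M₁ᵀ * M₂ᵀ).trace = (M₁ * M₂).trace := by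
      rw [← transpose_mul, trace_transpose, trace_mul_comm]
    rw [integral_trace_mul_trace, ← trace_transpose M₁, ← trace_transpose M₂,
      ← hM, ← hM', ← sum_mul_pairings]
    simp only [mul_sum (a := (d : ℂ) * ((d : ℂ) - 1) * ((d : ℂ) + 2))]
    refine sum_congr rfl fun i _ => sum_congr rfl fun j _ => sum_congr rfl fun k _ =>
      sum_congr rfl fun l _ => ?_
    have hinner := sum_mul_pairings A B
      ((d + 1) * ((1 : Matrix (Fin d) (Fin d) ℂ) i j * (1 : Matrix (Fin d) (Fin d) ℂ) k l) -
        (1 : Matrix (Fin d) (Fin d) ℂ) i k * (1 : Matrix (Fin d) (Fin d) ℂ) j l -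
        (1 : Matrix (Fin d) (Fin d) ℂ) i l * (1 : Matrix (Fin d) (Fin d) ℂ) j k)
      ((d + 1) * ((1 : Matrix (Fin d) (Fin d) ℂ) i k * (1 : Matrix (Fin d) (Fin d) ℂ) j l) -
        (1 : Matrix (Fin d) (Fin d) ℂ) i j * (1 : Matrix (Fin d) (Fin d) ℂ) k l -
        (1 : Matrix (Fin d) (Fin d) ℂ) i l * (1 : Matrix (Fin d) (Fin d) ℂ) j k)
      ((d + 1) * ((1 : Matrix (Fin d) (Fin d) ℂ) i l * (1 : Matrix (Fin d) (Fin d) ℂ) j k) -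
        (1 : Matrix (Fin d) (Fin d) ℂ) i j * (1 : Matrix (Fin d) (Fin d) ℂ) k l -
        (1 : Matrix (Fin d) (Fin d) ℂ) i k * (1 : Matrix (Fin d) (Fin d) ℂ) j l)
    rw [mul_left_comm]
    congr 1
    trans
    swap
    · refine hinner.trans ?_
      ring
    simp only [mul_sum]
    refine sum_congr rfl fun a _ => sum_congr rfl fun b _ => sum_congr rfl fun c _ =>
      sum_congr rfl fun e _ => ?_
    have h := congrArg Complex.ofReal (integral_entries μ a b c e i j k l)
    simp only [Fintype.card_fin] at h
    push_cast [hone] at h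
    linear_combination A a b * B c e * h
  refine mul_left_cancel₀ hD (key.trans ?_)
  rw [hc₁, hc₂, hc₃]
  generalize (d : ℂ) * ((d : ℂ) - 1) * ((d : ℂ) + 2) = D at hD ⊢
  field_simp
  ring
end

section
/- Let d ≥ 2, let ρ be a Hermitian d×d complex matrix with tr(ρ) = 1, and let M be a real observable (Hermitian with Mᵀ = M) satisfying tr(M) = 0 and tr(M²) = d. Then the second moment of real randomized measurements satisfies ∫_{O(d)} (tr(O·ρ·Oᵀ·M))² dμ_O(O) = (2/((d−1)(d+2))) · ( d·tr( ((ρ + ρᵀ)/2)² ) − 1 ). -/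
open MeasureTheory Matrix

namespace Matrix

instance compactSpace_orthogonalGroup {d : ℕ} :
    CompactSpace (orthogonalGroup (Fin d) ℝ) := by
  refine isCompact_iff_compactSpace.mp ?_
  have hbox : IsCompact {A : Fin d → Fin d → ℝ | ∀ i, A i ∈
      {r : Fin d → ℝ | ∀ j, r j ∈ Set.Icc (-1 : ℝ) 1}} :=
    isCompact_pi_infinite fun _ => isCompact_pi_infinite fun _ => isCompact_Icc
  refine hbox.of_isClosed_subset (isClosed_unitary (R := Matrix (Fin d) (Fin d) ℝ)) ?_
  intro A hA i j
  exact abs_le.mp (entry_norm_bound_of_unitary (𝕜 := ℝ) hA i j)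

end Matrix

lemma continuous_OC {d : ℕ} : Continuous (OC (d := d)) :=
  continuous_subtype_val.matrix_map Complex.continuous_ofReal

lemma OC_mul {d : ℕ} (P O : Matrix.orthogonalGroup (Fin d) ℝ) : OC (P * O) = OC P * OC O := by
  simp only [OC, Submonoid.coe_mul]
  exact Matrix.map_mul (f := Complex.ofRealHom)

lemma OC_transpose_mul_self {d : ℕ} (O : Matrix.orthogonalGroup (Fin d) ℝ) :
    (OC O)ᵀ * OC O = 1 := by
  have h : (O : Matrix (Fin d) (Fin d) ℝ)ᵀ * (O : Matrix (Fin d) (Fin d) ℝ) = 1 :=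
    (Matrix.mem_orthogonalGroup_iff' _ _).mp O.2
  have h' := congrArg (fun A => A.map Complex.ofRealHom) h
  simp only [Matrix.map_mul] at h'
  rw [Matrix.map_one _ (map_zero _) (map_one _)] at h'
  exact h'

/-- Conjugation of a complex matrix by a real orthogonal matrix. -/
def orthConj {d : ℕ} (S : Matrix (Fin d) (Fin d) ℂ) (O : Matrix.orthogonalGroup (Fin d) ℝ) :
    Matrix (Fin d) (Fin d) ℂ :=
  OC O * S * (OC O)ᵀ

lemma continuous_orthConj {d : ℕ} (S : Matrix (Fin d) (Fin d) ℂ) : Continuous (orthConj S) :=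
  (continuous_OC.matrix_mul continuous_const).matrix_mul continuous_OC.matrix_transpose

lemma orthConj_mul {d : ℕ} (S : Matrix (Fin d) (Fin d) ℂ)
    (P O : Matrix.orthogonalGroup (Fin d) ℝ) :
    orthConj S (P * O) = OC P * orthConj S O * (OC P)ᵀ := by
  simp only [orthConj, OC_mul, Matrix.transpose_mul, Matrix.mul_assoc]

lemma trace_orthConj {d : ℕ} (S : Matrix (Fin d) (Fin d) ℂ)
    (O : Matrix.orthogonalGroup (Fin d) ℝ) : (orthConj S O).trace = S.trace := by
  rw [orthConj, Matrix.trace_mul_cycle, OC_transpose_mul_self, Matrix.one_mul]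

lemma orthConj_mul_self {d : ℕ} (S : Matrix (Fin d) (Fin d) ℂ)
    (O : Matrix.orthogonalGroup (Fin d) ℝ) :
    orthConj S O * orthConj S O = orthConj (S * S) O := by
  calc orthConj S O * orthConj S O
      = OC O * S * ((OC O)ᵀ * OC O) * S * (OC O)ᵀ := by simp only [orthConj, Matrix.mul_assoc]
    _ = orthConj (S * S) O := by
        rw [OC_transpose_mul_self]; simp only [orthConj, Matrix.mul_assoc, Matrix.one_mul]

lemma orthConj_transpose {d : ℕ} (S : Matrix (Fin d) (Fin d) ℂ)
    (O : Matrix.orthogonalGroup (Fin d) ℝ) : (orthConj S O)ᵀ = orthConj Sᵀ O := by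
  simp only [orthConj, Matrix.transpose_mul, Matrix.transpose_transpose, Matrix.mul_assoc]

lemma orthConj_symm_apply {d : ℕ} {S : Matrix (Fin d) (Fin d) ℂ} (hS : Sᵀ = S)
    (O : Matrix.orthogonalGroup (Fin d) ℝ) (i j : Fin d) :
    orthConj S O i j = orthConj S O j i := by
  conv_lhs => rw [← hS, ← orthConj_transpose, Matrix.transpose_apply]

/-- Only the symmetric part of a matrix is seen by a symmetric observable. -/
lemma trace_orthConj_mul_symm {d : ℕ} (ρ M : Matrix (Fin d) (Fin d) ℂ) (hM : Mᵀ = M)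
    (O : Matrix.orthogonalGroup (Fin d) ℝ) :
    (orthConj ρ O * M).trace = (orthConj ((2 : ℂ)⁻¹ • (ρ + ρᵀ)) O * M).trace := by
  have h : (orthConj ρᵀ O * M).trace = (orthConj ρ O * M).trace := by
    rw [← Matrix.trace_transpose, Matrix.transpose_mul, hM, ← orthConj_transpose,
      Matrix.transpose_transpose, Matrix.trace_mul_comm]
  have h' : orthConj ((2 : ℂ)⁻¹ • (ρ + ρᵀ)) O = (2 : ℂ)⁻¹ • (orthConj ρ O + orthConj ρᵀ O) := by
    simp only [orthConj, Matrix.mul_smul, Matrix.smul_mul, Matrix.mul_add, Matrix.add_mul]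
  rw [h', Matrix.smul_mul, Matrix.add_mul, Matrix.trace_smul, Matrix.trace_add, h, smul_eq_mul]
  ring

/-- Permutation matrices as orthogonal matrices. -/
def permOrth {d : ℕ} (σ : Equiv.Perm (Fin d)) : Matrix.orthogonalGroup (Fin d) ℝ :=
  ⟨σ.permMatrix ℝ, by
    rw [Matrix.mem_orthogonalGroup_iff', ← Matrix.conjTranspose_eq_transpose_of_trivial,
      Matrix.conjTranspose_permMatrix, ← Matrix.permMatrix_mul, mul_inv_cancel,
      Matrix.permMatrix_one]⟩

lemma orthConj_permOrth_mul {d : ℕ} (S : Matrix (Fin d) (Fin d) ℂ) (σ : Equiv.Perm (Fin d))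
    (O : Matrix.orthogonalGroup (Fin d) ℝ) (i j : Fin d) :
    orthConj S (permOrth σ * O) i j = orthConj S O (σ i) (σ j) := by
  rw [orthConj_mul]
  simp [OC, permOrth, Matrix.mul_apply, Equiv.Perm.permMatrix, PEquiv.toMatrix_apply,
    apply_ite Complex.ofReal, Finset.sum_ite_eq]

lemma exists_perm_pair {α : Type*} [DecidableEq α] {i j k l : α} (hij : i ≠ j) (hkl : k ≠ l) :
    ∃ σ : Equiv.Perm α, σ i = k ∧ σ j = l := by
  refine ⟨Equiv.swap (Equiv.swap i k j) l * Equiv.swap i k, ?_, ?_⟩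
  · rw [Equiv.Perm.mul_apply, Equiv.swap_apply_left]
    refine Equiv.swap_apply_of_ne_of_ne (fun h => hij ?_) hkl
    apply (Equiv.swap i k).injective
    rw [← h, Equiv.swap_apply_left]
  · rw [Equiv.Perm.mul_apply, Equiv.swap_apply_left]

section Moments

variable {d : ℕ} [MeasurableSpace (Matrix.orthogonalGroup (Fin d) ℝ)]
  [BorelSpace (Matrix.orthogonalGroup (Fin d) ℝ)]
  (μ : Measure (Matrix.orthogonalGroup (Fin d) ℝ)) [μ.IsHaarMeasure]
  (S : Matrix (Fin d) (Fin d) ℂ)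

/-- Second moments of the entries of the orthogonally conjugated matrix. -/
noncomputable def entryMoment (i j k l : Fin d) : ℂ :=
  ∫ O, orthConj S O i j * orthConj S O k l ∂μ

lemma integrable_entry_mul (i j k l : Fin d) :
    Integrable (fun O => orthConj S O i j * orthConj S O k l) μ := by
  have h := continuous_orthConj S
  exact ((h.matrix_elem i j).mul (h.matrix_elem k l)).integrable_of_hasCompactSupport
    (HasCompactSupport.of_compactSpace _)

lemma entryMoment_perm (σ : Equiv.Perm (Fin d)) (i j k l : Fin d) :
    entryMoment μ S (σ i) (σ j) (σ k) (σ l) = entryMoment μ S i j k l := by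
  unfold entryMoment
  rw [← integral_mul_left_eq_self (fun O => orthConj S O i j * orthConj S O k l) (permOrth σ)]
  simp only [orthConj_permOrth_mul]

lemma entryMoment_diag (i j : Fin d) : entryMoment μ S i i i i = entryMoment μ S j j j j := by
  have h := entryMoment_perm μ S (Equiv.swap j i) j j j j
  rwa [Equiv.swap_apply_left] at h

lemma entryMoment_offDiag {i j k l : Fin d} (hij : i ≠ j) (hkl : k ≠ l) :
    entryMoment μ S i i j j = entryMoment μ S k k l l := by
  obtain ⟨σ, h1, h2⟩ := exists_perm_pair hkl hij
  have h := entryMoment_perm μ S σ k k l l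
  rwa [h1, h2] at h

/-- The second moment against a traceless real symmetric matrix is a multiple of its squared
Frobenius norm. -/
lemma integral_trace_sq_of_traceless {p q : Fin d} (hpq : p ≠ q)
    (A : Matrix (Fin d) (Fin d) ℝ) (hA : Aᵀ = A) (hAtr : A.trace = 0) :
    ∫ O, (orthConj S O * A.map Complex.ofReal).trace ^ 2 ∂μ =
      (entryMoment μ S p p p p - entryMoment μ S p p q q) * ((A * A).trace : ℝ) := by
  have hH : A.IsHermitian := by rw [Matrix.IsHermitian, conjTranspose_eq_transpose_of_trivial, hA]
  set U : Matrix.orthogonalGroup (Fin d) ℝ := hH.eigenvectorUnitary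
  set m := hH.eigenvalues
  have hspec : A = (U : Matrix (Fin d) (Fin d) ℝ) * diagonal m *
      (U : Matrix (Fin d) (Fin d) ℝ)ᵀ := by
    have h := hH.spectral_theorem
    rw [Unitary.conjStarAlgAut_apply] at h
    exact h
  have hUU : (U : Matrix (Fin d) (Fin d) ℝ)ᵀ * (U : Matrix (Fin d) (Fin d) ℝ) = 1 :=
    (Matrix.mem_orthogonalGroup_iff' _ _).mp U.2
  have htr : ∑ i, m i = 0 := by
    rw [← hAtr, hspec, Matrix.trace_mul_cycle, hUU, Matrix.one_mul, Matrix.trace_diagonal]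
  have htr2 : (A * A).trace = ∑ i, m i ^ 2 := by
    have h : A * A = (U : Matrix (Fin d) (Fin d) ℝ) * (diagonal m * diagonal m) *
        (U : Matrix (Fin d) (Fin d) ℝ)ᵀ := by
      calc A * A = (U : Matrix (Fin d) (Fin d) ℝ) * diagonal m *
            ((U : Matrix (Fin d) (Fin d) ℝ)ᵀ * (U : Matrix (Fin d) (Fin d) ℝ)) * diagonal m *
            (U : Matrix (Fin d) (Fin d) ℝ)ᵀ := by
              conv_lhs => rw [hspec]
              simp only [Matrix.mul_assoc]
        _ = _ := by rw [hUU]; simp only [Matrix.mul_assoc, Matrix.one_mul]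
    rw [h, Matrix.trace_mul_cycle, hUU, Matrix.one_mul, Matrix.diagonal_mul_diagonal,
      Matrix.trace_diagonal]
    simp only [sq]
  have hspecC : A.map Complex.ofReal =
      OC U * diagonal (fun i => (m i : ℂ)) * (OC U)ᵀ := by
    have h := congrArg (fun B => B.map Complex.ofRealHom) hspec
    simp only [Matrix.map_mul] at h
    rw [Matrix.diagonal_map (map_zero _), Matrix.transpose_map] at h
    exact h
  have key : ∀ O, (orthConj S (U * O) * A.map Complex.ofReal).trace ^ 2 =
      ∑ i, ∑ k, ((m i : ℂ) * m k) * (orthConj S O i i * orthConj S O k k) := by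
    intro O
    have h : (orthConj S (U * O) * A.map Complex.ofReal).trace =
        ∑ i, (m i : ℂ) * orthConj S O i i := by
      rw [hspecC, orthConj_mul]
      calc _ = (OC U * (orthConj S O * ((OC U)ᵀ * OC U) * diagonal (fun i => (m i : ℂ))) *
              (OC U)ᵀ).trace := by simp only [Matrix.mul_assoc]
        _ = (orthConj S O * diagonal (fun i => (m i : ℂ))).trace := by
            rw [Matrix.trace_mul_cycle, OC_transpose_mul_self, Matrix.one_mul, Matrix.mul_one]
        _ = _ := by simp only [Matrix.trace, Matrix.diag, Matrix.mul_diagonal, mul_comm]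
    rw [h, sq, Finset.sum_mul_sum]
    refine Finset.sum_congr rfl fun i _ => Finset.sum_congr rfl fun k _ => ?_
    ring
  rw [← integral_mul_left_eq_self _ U]
  simp only [key]
  rw [integral_finsetSum _ fun i _ => integrable_finsetSum _ fun k _ =>
    (integrable_entry_mul μ S i i k k).const_mul _]
  have hterm : ∀ i k, entryMoment μ S i i k k = entryMoment μ S p p q q +
      if i = k then entryMoment μ S p p p p - entryMoment μ S p p q q else 0 := by
    intro i k
    split_ifs with hik
    · subst hik
      rw [entryMoment_diag μ S i p]; ring
    · rw [entryMoment_offDiag μ S hik hpq, add_zero]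
  have hsum : ∀ i, ∫ O, ∑ k, ((m i : ℂ) * m k) * (orthConj S O i i * orthConj S O k k) ∂μ =
      entryMoment μ S p p q q * m i * ∑ k, (m k : ℂ) +
        (entryMoment μ S p p p p - entryMoment μ S p p q q) * (m i : ℂ) ^ 2 := by
    intro i
    rw [integral_finsetSum _ fun k _ => (integrable_entry_mul μ S i i k k).const_mul _]
    simp only [integral_const_mul]
    change ∑ k, ((m i : ℂ) * m k) * entryMoment μ S i i k k = _
    simp only [hterm i, mul_add, mul_ite, mul_zero, Finset.sum_add_distrib, Finset.sum_ite_eq,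
      Finset.mem_univ, if_true, Finset.mul_sum]
    congr 1
    · exact Finset.sum_congr rfl fun k _ => by ring
    · ring
  have htrC : ∑ i, (m i : ℂ) = 0 := by exact_mod_cast congrArg Complex.ofReal htr
  simp only [hsum, htrC, mul_zero, zero_add]
  rw [← Finset.mul_sum, htr2]
  push_cast
  rfl

/-- The second moment of an off-diagonal entry in terms of those of the diagonal entries. -/
lemma two_mul_entryMoment_offDiag (hS : Sᵀ = S) {p q i k : Fin d} (hpq : p ≠ q) (hik : i ≠ k) :
    2 * entryMoment μ S i k k i =
      entryMoment μ S p p p p - entryMoment μ S p p q q := by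
  have h := integral_trace_sq_of_traceless μ S hpq
    (Matrix.single i k (1 : ℝ) + Matrix.single k i 1)
    (by simp [Matrix.transpose_add, add_comm])
    (by simp [Matrix.trace_add, Matrix.trace_single_eq_of_ne, hik, hik.symm])
  have h2 : ((Matrix.single i k (1 : ℝ) + Matrix.single k i 1) *
      (Matrix.single i k (1 : ℝ) + Matrix.single k i 1)).trace = 2 := by
    simp [Matrix.mul_add, Matrix.add_mul, Matrix.trace_add, hik, hik.symm]
    norm_num
  have h3 : ∀ O, (orthConj S O * (Matrix.single i k (1 : ℝ) +
      Matrix.single k i 1).map Complex.ofReal).trace ^ 2 =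
      4 * (orthConj S O i k * orthConj S O k i) := by
    intro O
    have hmap : (Matrix.single i k (1 : ℝ) + Matrix.single k i 1).map Complex.ofReal =
        Matrix.single i k (1 : ℂ) + Matrix.single k i 1 := by
      ext a b
      simp [Matrix.single_apply, apply_ite Complex.ofReal]
    rw [hmap, Matrix.mul_add, Matrix.trace_add, Matrix.trace_mul_single, Matrix.trace_mul_single,
      orthConj_symm_apply hS O k i]
    simp only [MulOpposite.op_one, one_smul]
    ring
  simp only [h3, integral_const_mul, h2] at h
  change 4 * entryMoment μ S i k k i = _ at h
  push_cast at h
  linear_combination h / 2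

lemma sum_entryMoment_diag [IsProbabilityMeasure μ] :
    ∑ i, ∑ k, entryMoment μ S i i k k = S.trace ^ 2 := by
  have h : ∀ O, ∑ i, ∑ k, orthConj S O i i * orthConj S O k k = S.trace ^ 2 := by
    intro O
    rw [← trace_orthConj S O, sq, Matrix.trace, Finset.sum_mul_sum]
    rfl
  unfold entryMoment
  simp only [← integral_finsetSum _ fun k _ => integrable_entry_mul μ S _ _ k k]
  rw [← integral_finsetSum _ fun i _ => integrable_finsetSum _ fun k _ =>
    integrable_entry_mul μ S i i k k]
  simp [h]

lemma sum_entryMoment_offDiag [IsProbabilityMeasure μ] :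
    ∑ i, ∑ k, entryMoment μ S i k k i = (S * S).trace := by
  have h : ∀ O, ∑ i, ∑ k, orthConj S O i k * orthConj S O k i = (S * S).trace := by
    intro O
    rw [← trace_orthConj (S * S) O, ← orthConj_mul_self]
    rfl
  unfold entryMoment
  simp only [← integral_finsetSum _ fun k _ => integrable_entry_mul μ S _ k k _]
  rw [← integral_finsetSum _ fun i _ => integrable_finsetSum _ fun k _ =>
    integrable_entry_mul μ S i k k i]
  simp [h]

end Moments

lemma sum_sum_ite_eq_diag {d : ℕ} (x y : ℂ) :
    ∑ i : Fin d, ∑ k : Fin d, (if i = k then x else y) = d * x + d * (d - 1) * y := by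
  have h : ∀ i k : Fin d, (if i = k then x else y) = y + if i = k then x - y else 0 := by
    intro i k
    split_ifs <;> ring
  simp only [h, Finset.sum_add_distrib, Finset.sum_ite_eq, Finset.mem_univ, if_true,
    Finset.sum_const, Finset.card_univ, Fintype.card_fin, nsmul_eq_mul]
  ring

/-- the second moment of real randomized measurements on a single qudit. -/
theorem stmt_4 (d : ℕ) (hd : 2 ≤ d)
    [MeasurableSpace (Matrix.orthogonalGroup (Fin d) ℝ)]
    [BorelSpace (Matrix.orthogonalGroup (Fin d) ℝ)]
    (μ : Measure (Matrix.orthogonalGroup (Fin d) ℝ))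
    [μ.IsHaarMeasure] [IsProbabilityMeasure μ]
    (ρ M : Matrix (Fin d) (Fin d) ℂ)
    (hρ : ρ.IsHermitian) (hρtr : ρ.trace = 1)
    (hM : M.IsHermitian) (hMreal : Mᵀ = M)
    (hMtr : M.trace = 0) (hM2 : (M * M).trace = (d : ℂ)) :
    ∫ O, (OC O * ρ * (OC O)ᵀ * M).trace ^ 2 ∂μ =
      (2 / (((d : ℂ) - 1) * ((d : ℂ) + 2))) *
        ((d : ℂ) * (((2 : ℂ)⁻¹ • (ρ + ρᵀ)) * ((2 : ℂ)⁻¹ • (ρ + ρᵀ))).trace - 1) := by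
  have hsymm : ∀ O, (OC O * ρ * (OC O)ᵀ * M).trace =
      (orthConj ((2 : ℂ)⁻¹ • (ρ + ρᵀ)) O * M).trace :=
    fun O => trace_orthConj_mul_symm ρ M hMreal O
  simp only [hsymm]
  set S := (2 : ℂ)⁻¹ • (ρ + ρᵀ) with hSdef
  have hS : Sᵀ = S := by
    rw [hSdef, Matrix.transpose_smul, Matrix.transpose_add, Matrix.transpose_transpose, add_comm]
  have hStr : S.trace = 1 := by
    rw [hSdef, Matrix.trace_smul, Matrix.trace_add, Matrix.trace_transpose, hρtr, smul_eq_mul]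
    norm_num
  obtain ⟨A, hAM⟩ : ∃ A : Matrix (Fin d) (Fin d) ℝ, A.map Complex.ofReal = M := by
    refine ⟨M.map Complex.re, ?_⟩
    ext i j
    have h := hM.apply i j
    rw [← Matrix.transpose_apply M, hMreal] at h
    exact Complex.conj_eq_iff_re.mp h
  have hA : Aᵀ = A := by
    apply Matrix.map_injective Complex.ofReal_injective
    change Aᵀ.map Complex.ofReal = A.map Complex.ofReal
    rw [Matrix.transpose_map, hAM, hMreal]
  have hAtr : A.trace = 0 := by
    apply Complex.ofReal_injective
    rw [← hAM] at hMtr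
    simpa [Matrix.trace] using hMtr
  have hA2 : (((A * A).trace : ℝ) : ℂ) = d := by
    rw [← hM2, ← hAM]
    simp [Matrix.trace, Matrix.mul_apply]
  let p : Fin d := ⟨0, by lia⟩
  let q : Fin d := ⟨1, by lia⟩
  have hpq : p ≠ q := by simp [p, q]
  rw [← hAM, integral_trace_sq_of_traceless μ S hpq A hA hAtr, hA2]
  have hdiag := sum_entryMoment_diag μ S
  have hoff := sum_entryMoment_offDiag μ S
  set a := entryMoment μ S p p p p with ha
  set b := entryMoment μ S p p q q
  have h1 : ∀ i k, entryMoment μ S i i k k = if i = k then a else b := by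
    intro i k
    split_ifs with hik
    · rw [← hik, ha, entryMoment_diag μ S i p]
    · exact entryMoment_offDiag μ S hik hpq
  have h2 : ∀ i k, entryMoment μ S i k k i = if i = k then a else (a - b) / 2 := by
    intro i k
    split_ifs with hik
    · rw [← hik, ha, entryMoment_diag μ S i p]
    · linear_combination (two_mul_entryMoment_offDiag μ S hS hpq hik) / 2
  simp only [h1, sum_sum_ite_eq_diag, hStr] at hdiag
  simp only [h2, sum_sum_ite_eq_diag] at hoff
  have hd1 : (d : ℂ) - 1 ≠ 0 := by
    rw [sub_ne_zero]
    exact_mod_cast (by lia : d ≠ 1)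
  have hd2 : (d : ℂ) + 2 ≠ 0 := by exact_mod_cast (by lia : d + 2 ≠ 0)
  rw [div_mul_eq_mul_div, eq_div_iff (mul_ne_zero hd1 hd2)]
  linear_combination 2 * d * hoff - 2 * hdiag
end

section
/- Let d ≥ 2 and let ρ be a Hermitian complex matrix indexed by Fin d × Fin d with tr(ρ) = 1. With the moments R, Q, Q̂ of ρ defined via Haar integrals over U(d)×U(d) and O(d)×O(d) exactly as follows — R = ∬ (tr((U_A ⊗ U_B)ρ(U_A ⊗ U_B)ᴴ(N_A ⊗ N_B)))² dμ_U dμ_U for Hermitian N_A, N_B with tr(N_X) = 0, tr(N_X²) = d; Q = ∬ (tr((O_A ⊗ O_B)ρ(O_Aᵀ ⊗ O_Bᵀ)(M_A ⊗ M_B)))² dμ_O dμ_O for real observables M_A, M_B with tr(M_X) = 0, tr(M_X²) = d; Q̂ = ∬ (tr((O_A ⊗ O_B)ρ(O_Aᵀ ⊗ O_Bᵀ)(M̂_A ⊗ M̂_B)))² dμ_O dμ_O for imaginary observables M̂_A, M̂_B with tr(M̂_X²) = d — and with reduced matrices ρ_A, ρ_B given by the partial traces, one has the identity ‖ρ − ρᵀ‖_F²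 = (1/d)·(‖ρ_A − ρ_Aᵀ‖_F² + ‖ρ_B − ρ_Bᵀ‖_F²) + (4/d²)·( (d²−1)²·R − L²·Q − L̂²·Q̂ ), where L = (d−1)(d+2)/2 and L̂ = d(d−1)/2. -/
open MeasureTheory Matrix Kronecker

/-- The reduced matrix on the first factor: `(ρ_A)_{j,j'} = Σ_k ρ_{(j,k),(j',k)}`. -/
noncomputable def redA {d : ℕ} (ρ : Matrix (Fin d × Fin d) (Fin d × Fin d) ℂ) : Matrix (Fin d) (Fin d) ℂ :=
  Matrix.of fun j j' => ∑ k, ρ (j, k) (j', k)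

/-- The reduced matrix on the second factor: `(ρ_B)_{k,k'} = Σ_j ρ_{(j,k),(j,k')}`. -/
noncomputable def redB {d : ℕ} (ρ : Matrix (Fin d × Fin d) (Fin d × Fin d) ℂ) : Matrix (Fin d) (Fin d) ℂ :=
  Matrix.of fun k k' => ∑ j, ρ (j, k) (j, k')

/-- The squared Frobenius norm `‖X‖_F² = tr(Xᴴ X)` (as a real number). -/
noncomputable def fro2 {n : Type*} [Fintype n] (X : Matrix n n ℂ) : ℝ :=
  ((Xᴴ * X).trace).re

/-- A four-index tensor invariant under the orthogonal group acting on every index. -/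
def IsOrthogonalInvariant {n : Type*} [Fintype n] [DecidableEq n] (T : n → n → n → n → ℂ) : Prop :=
  ∀ O ∈ Matrix.orthogonalGroup n ℝ, ∀ a b c e, T a b c e =
    ∑ i, (O i a : ℂ) * ∑ j, (O j b : ℂ) * ∑ k, (O k c : ℂ) * ∑ l, (O l e : ℂ) * T i j k l

/-- The isotropic four-index tensor with coefficients `α`, `β`, `γ`. -/
def isotropicTensor {n : Type*} [DecidableEq n] (α β γ : ℂ) (a b c e : n) : ℂ :=
  α * (if a = b ∧ c = e then 1 else 0) + β * (if a = c ∧ b = e then 1 else 0) +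
    γ * (if a = e ∧ b = c then 1 else 0)

namespace IsOrthogonalInvariant

variable {n : Type*} [Fintype n] [DecidableEq n] {T : n → n → n → n → ℂ}

theorem apply_eq_sign_mul (hT : IsOrthogonalInvariant T) (ε : n → ℝ) (hε : ∀ i, ε i * ε i = 1)
    (a b c e : n) : T a b c e = ε a * (ε b * (ε c * (ε e * T a b c e))) := by
  have hO : Matrix.diagonal ε ∈ Matrix.orthogonalGroup n ℝ := by
    rw [Matrix.mem_orthogonalGroup_iff]
    simp [hε]
  have h := hT _ hO a b c e
  have key : ∀ (x : n) (F : n → ℂ), ∑ i, ((Matrix.diagonal ε i x : ℝ) : ℂ) * F i = ε x * F x := by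
    intro x F
    rw [Finset.sum_eq_single x] <;> simp +contextual
  simpa only [key] using h

theorem apply_perm (hT : IsOrthogonalInvariant T) (σ : Equiv.Perm n) (a b c e : n) :
    T a b c e = T (σ a) (σ b) (σ c) (σ e) := by
  have hO : (Matrix.of fun i j => if i = σ j then (1 : ℝ) else 0) ∈ Matrix.orthogonalGroup n ℝ := by
    rw [Matrix.mem_orthogonalGroup_iff']
    ext i j
    simp [Matrix.mul_apply, Matrix.one_apply, eq_comm]
  have h := hT _ hO a b c e
  have key : ∀ (x : n) (F : n → ℂ),
      ∑ i, (((Matrix.of fun i j => if i = σ j then (1 : ℝ) else 0) i x : ℝ) : ℂ) * F i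
        = F (σ x) := by
    intro x F
    rw [Finset.sum_eq_single (σ x)] <;> simp +contextual
  simpa only [key] using h

theorem apply_self (hT : IsOrthogonalInvariant T) {a b : n} (hab : a ≠ b) :
    4 * T a a a a = ∑ i ∈ {a, b}, ∑ j ∈ {a, b}, ∑ k ∈ {a, b}, ∑ l ∈ {a, b}, T i j k l := by
  have hs : (√2)⁻¹ * (√2)⁻¹ = (1 / 2 : ℝ) := by
    rw [← mul_inv, Real.mul_self_sqrt (by norm_num)]; norm_num
  set s : ℝ := (√2)⁻¹
  let v : n → n → ℝ := fun j =>
    if j = a then s • (Pi.single a 1 + Pi.single b 1)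
    else if j = b then s • (Pi.single a 1 - Pi.single b 1) else Pi.single j 1
  have hO : (Matrix.of fun i j => v j i) ∈ Matrix.orthogonalGroup n ℝ := by
    rw [Matrix.mem_orthogonalGroup_iff']
    ext j k
    change v j ⬝ᵥ v k = (1 : Matrix n n ℝ) j k
    simp only [v, Matrix.one_apply]
    split_ifs <;> subst_vars <;>
      simp_all [dotProduct_add, dotProduct_sub, eq_comm] <;> linarith
  have h := hT _ hO a a a a
  have key : ∀ F : n → ℂ, ∑ i, (((Matrix.of fun i j => v j i) i a : ℝ) : ℂ) * F i
      = s * ∑ i ∈ {a, b}, F i := by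
    intro F
    have : ∀ i, (((Matrix.of fun i j => v j i) i a : ℝ) : ℂ) * F i =
        (if i = a then s * F a else 0) + (if i = b then s * F b else 0) := by
      intro i
      simp only [v, Matrix.of_apply, if_true, Pi.smul_apply, Pi.add_apply, Pi.single_apply]
      by_cases h1 : i = a <;> by_cases h2 : i = b <;> simp_all
    simp only [this, Finset.sum_add_distrib, Finset.sum_ite_eq', Finset.mem_univ, if_true,
      Finset.sum_pair hab, mul_add]
  simp only [key, ← Finset.mul_sum] at h
  have hs4 : (s : ℂ) * (s * (s * s)) = 1 / 4 := by
    have : s * (s * (s * s)) = 1 / 4 := by rw [hs, ← mul_assoc, hs]; norm_num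
    rw [← Complex.ofReal_mul, ← Complex.ofReal_mul, ← Complex.ofReal_mul, this]
    norm_num
  linear_combination 4 * h +
    4 * (∑ i ∈ {a, b}, ∑ j ∈ {a, b}, ∑ k ∈ {a, b}, ∑ l ∈ {a, b}, T i j k l) * hs4

theorem apply_eq_zero (hT : IsOrthogonalInvariant T) {a b c e : n}
    (h1 : ¬(a = b ∧ c = e)) (h2 : ¬(a = c ∧ b = e)) (h3 : ¬(a = e ∧ b = c)) : T a b c e = 0 := by
  have h : ∀ x : n, T a b c e = _ := fun x =>
    hT.apply_eq_sign_mul (fun i => if i = x then -1 else 1) (by intro i; split_ifs <;> norm_num) a b c e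
  simp only [apply_ite Complex.ofReal, Complex.ofReal_neg, Complex.ofReal_one] at h
  have ha := h a
  have hb := h b
  have hc := h c
  have he := h e
  grind

theorem exists_eq_isotropicTensor [Nontrivial n] (hT : IsOrthogonalInvariant T) :
    ∃ α β γ, T = isotropicTensor α β γ := by
  obtain ⟨x, y, hxy⟩ := exists_pair_ne n
  have hpair : ∀ {a b : n}, a ≠ b → ∃ σ : Equiv.Perm n, σ a = x ∧ σ b = y := fun hab =>
    (MulAction.is_two_pretransitive_iff (G := Equiv.Perm n) (α := n)).1
      (Equiv.Perm.isMultiplyPretransitive n 2) hab hxy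
  have h1 : ∀ {a b : n}, a ≠ b → T a a b b = T x x y y := fun hab => by
    obtain ⟨σ, rfl, rfl⟩ := hpair hab
    exact hT.apply_perm σ _ _ _ _
  have h2 : ∀ {a b : n}, a ≠ b → T a b a b = T x y x y := fun hab => by
    obtain ⟨σ, rfl, rfl⟩ := hpair hab
    exact hT.apply_perm σ _ _ _ _
  have h3 : ∀ {a b : n}, a ≠ b → T a b b a = T x y y x := fun hab => by
    obtain ⟨σ, rfl, rfl⟩ := hpair hab
    exact hT.apply_perm σ _ _ _ _
  have h4 : ∀ a : n, T a a a a = T x x y y + T x y x y + T x y y x := fun a => by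
    obtain ⟨b, hb⟩ := exists_ne a
    have h := hT.apply_self hb.symm
    have hbb : T b b b b = T a a a a := by simpa using hT.apply_perm (Equiv.swap a b) b b b b
    simp only [Finset.sum_pair hb.symm] at h
    rw [h1 hb, h1 hb.symm, h2 hb, h2 hb.symm, h3 hb, h3 hb.symm, hbb,
      hT.apply_eq_zero (a := a) (b := a) (c := a) (e := b) (by grind) (by grind) (by grind),
      hT.apply_eq_zero (a := a) (b := a) (c := b) (e := a) (by grind) (by grind) (by grind),
      hT.apply_eq_zero (a := a) (b := b) (c := a) (e := a) (by grind) (by grind) (by grind),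
      hT.apply_eq_zero (a := b) (b := a) (c := a) (e := a) (by grind) (by grind) (by grind),
      hT.apply_eq_zero (a := b) (b := b) (c := b) (e := a) (by grind) (by grind) (by grind),
      hT.apply_eq_zero (a := b) (b := b) (c := a) (e := b) (by grind) (by grind) (by grind),
      hT.apply_eq_zero (a := b) (b := a) (c := b) (e := b) (by grind) (by grind) (by grind),
      hT.apply_eq_zero (a := a) (b := b) (c := b) (e := b) (by grind) (by grind) (by grind)] at h
    linear_combination h / 2
  refine ⟨T x x y y, T x y x y, T x y y x, ?_⟩
  ext a b c e
  unfold isotropicTensor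
  by_cases hab : a = b ∧ c = e
  · obtain ⟨rfl, rfl⟩ := hab
    by_cases hac : a = c
    · subst hac; simp [h4]
    · simp [hac, h1 hac]
  by_cases hac : a = c ∧ b = e
  · obtain ⟨rfl, rfl⟩ := hac
    have : a ≠ b := by grind
    simp [this, this.symm, h2 this]
  by_cases hae : a = e ∧ b = c
  · obtain ⟨rfl, rfl⟩ := hae
    have : a ≠ b := by grind
    simp [this, h3 this]
  simp [hab, hac, hae, hT.apply_eq_zero hab hac hae]

end IsOrthogonalInvariant

theorem isCompact_unitaryGroup (n 𝕜 : Type*) [Fintype n] [DecidableEq n] [RCLike 𝕜] :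
    IsCompact (Matrix.unitaryGroup n 𝕜 : Set (Matrix n n 𝕜)) := by
  have hK : IsCompact (Set.univ.pi fun _ : n => Set.univ.pi fun _ : n =>
      Metric.closedBall (0 : 𝕜) 1) :=
    isCompact_univ_pi fun _ => isCompact_univ_pi fun _ => isCompact_closedBall _ _
  exact hK.of_isClosed_subset (isClosed_unitary (R := Matrix n n 𝕜)) fun U hU => by
    simpa using fun i j => entry_norm_bound_of_unitary hU i j

theorem isMulRightInvariant_of_compactSpace {G : Type*} [Group G] [TopologicalSpace G]
    [IsTopologicalGroup G] [CompactSpace G] [MeasurableSpace G] [BorelSpace G] (μ : Measure G)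
    [μ.IsHaarMeasure] [IsProbabilityMeasure μ] : μ.IsMulRightInvariant where
  map_mul_right_eq_self g := by
    have := Measure.isProbabilityMeasure_map (μ := μ) (f := (· * g))
      (continuous_mul_const g).aemeasurable
    exact Measure.isHaarMeasure_eq_of_isProbabilityMeasure _ _


theorem sum_mul_isotropicTensor {n : Type*} [Fintype n] [DecidableEq n]
    (F : n → n → n → n → ℂ) (α β γ : ℂ) :
    ∑ a, ∑ b, ∑ c, ∑ e, F a b c e * isotropicTensor α β γ a b c e =
      α * ∑ a, ∑ c, F a a c c + β * ∑ a, ∑ b, F a b a b + γ * ∑ a, ∑ b, F a b b a := by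
  have h : ∀ (p q : Prop) [Decidable p] [Decidable q] (x y : ℂ),
      x * (y * if p ∧ q then 1 else 0) = if p then (if q then y * x else 0) else 0 := by
    intro p q _ _ x y
    split_ifs <;> simp_all [mul_comm]
  simp only [isotropicTensor, mul_add, Finset.sum_add_distrib, h, Finset.mul_sum]
  congr 1
  · congr 1
    · simp only [Finset.sum_ite_eq, Finset.mem_univ, if_true, Finset.sum_ite_irrel,
        Finset.sum_const_zero]
    · simp only [Finset.sum_ite_eq, Finset.mem_univ, if_true, Finset.sum_ite_irrel,
        Finset.sum_const_zero]
  · refine Finset.sum_congr rfl fun a _ => Finset.sum_congr rfl fun b _ => ?_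
    simp only [Finset.sum_ite_eq, Finset.mem_univ, if_true]

/-- The second moments of the entries of the random matrix `X` are those of an isotropic tensor. -/
def HasIsotropicMoments {Ω n : Type*} [DecidableEq n] [MeasurableSpace Ω] (μ : Measure Ω)
    (X : Ω → Matrix n n ℂ) (α β γ : ℂ) : Prop :=
  ∀ a b c e, Integrable (fun g => X g a b * X g c e) μ ∧
    ∫ g, X g a b * X g c e ∂μ = isotropicTensor α β γ a b c e

namespace HasIsotropicMoments

variable {Ω n : Type*} [DecidableEq n] [MeasurableSpace Ω] {μ : Measure Ω}
  {X : Ω → Matrix n n ℂ} {α β γ : ℂ}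

theorem isotropicTensor_eq_mul (h : HasIsotropicMoments μ X α β γ)
    {s : ℂ} {a b c e a' b' c' e' : n}
    (hX : ∀ g, X g a b * X g c e = s * (X g a' b' * X g c' e')) :
    isotropicTensor α β γ a b c e = s * isotropicTensor α β γ a' b' c' e' := by
  rw [← (h _ _ _ _).2, ← (h _ _ _ _).2, ← integral_const_mul]
  simp only [hX]

theorem eq_of_symm [Nontrivial n] (h : HasIsotropicMoments μ X α β γ) (hX : ∀ g, (X g)ᵀ = X g) :
    β = γ := by
  obtain ⟨x, y, hxy⟩ := exists_pair_ne n
  have := h.isotropicTensor_eq_mul (s := 1) (a := x) (b := y) (c := x) (e := y)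
    (a' := x) (b' := y) (c' := y) (e' := x) fun g => by
      rw [one_mul, ← Matrix.transpose_apply (X g) x y, hX]
  simpa [isotropicTensor, hxy, hxy.symm] using this

theorem eq_of_antisymm [Nontrivial n] (h : HasIsotropicMoments μ X α β γ)
    (hX : ∀ g, (X g)ᵀ = -X g) : α = 0 ∧ β = -γ := by
  obtain ⟨x, y, hxy⟩ := exists_pair_ne n
  have hX' : ∀ g a b, X g a b = - X g b a := fun g a b => by
    rw [← Matrix.transpose_apply (X g) b a, hX, Matrix.neg_apply]
  constructor
  · have := h.isotropicTensor_eq_mul (s := -1) (a := x) (b := x) (c := y) (e := y)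
      (a' := x) (b' := x) (c' := y) (e' := y) fun g => by
        nth_rw 1 [hX' g x x]; ring
    simp only [isotropicTensor, hxy] at this
    simp at this
    linear_combination this / 2
  · have := h.isotropicTensor_eq_mul (s := -1) (a := x) (b := y) (c := x) (e := y)
      (a' := x) (b' := y) (c' := y) (e' := x) fun g => by
        nth_rw 2 [hX' g x y]; ring
    simpa [isotropicTensor, hxy, hxy.symm] using this

variable [Fintype n]

theorem integrable_trace_mul_trace (h : HasIsotropicMoments μ X α β γ) (Y Z : Matrix n n ℂ) :
    Integrable (fun g => (Y * X g).trace * (Z * X g).trace) μ := by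
  simp only [Matrix.trace, Matrix.diag, Matrix.mul_apply, Finset.sum_mul_sum]
  refine integrable_finsetSum _ fun b _ => integrable_finsetSum _ fun e _ =>
    integrable_finsetSum _ fun a _ => integrable_finsetSum _ fun c _ => ?_
  refine ((h a b c e).1.const_mul (Y b a * Z e c)).congr (ae_of_all _ fun g => ?_)
  ring

theorem integral_trace_mul_trace (h : HasIsotropicMoments μ X α β γ) (Y Z : Matrix n n ℂ) :
    ∫ g, (Y * X g).trace * (Z * X g).trace ∂μ =
      α * (Y.trace * Z.trace) + β * (Y * Zᵀ).trace + γ * (Y * Z).trace := by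
  have hint : ∀ a b c e, Integrable (fun g => Y b a * Z e c * (X g a b * X g c e)) μ :=
    fun a b c e => (h a b c e).1.const_mul _
  have hexp : ∀ g, (Y * X g).trace * (Z * X g).trace =
      ∑ a, ∑ b, ∑ c, ∑ e, Y b a * Z e c * (X g a b * X g c e) := by
    intro g
    rw [Matrix.trace_mul_comm Y, Matrix.trace_mul_comm Z]
    simp only [Matrix.trace, Matrix.diag, Matrix.mul_apply, Finset.sum_mul]
    simp only [Finset.mul_sum]
    exact Finset.sum_congr rfl fun a _ => Finset.sum_congr rfl fun b _ =>
      Finset.sum_congr rfl fun c _ => Finset.sum_congr rfl fun e _ => by ring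
  simp only [hexp]
  rw [integral_finsetSum _ fun a _ => integrable_finsetSum _ fun b _ =>
    integrable_finsetSum _ fun c _ => integrable_finsetSum _ fun e _ => hint a b c e]
  simp_rw [integral_finsetSum _ fun b _ => integrable_finsetSum _ fun c _ =>
    integrable_finsetSum _ fun e _ => hint _ b c e,
    integral_finsetSum _ fun c _ => integrable_finsetSum _ fun e _ => hint _ _ c e,
    integral_finsetSum _ fun e _ => hint _ _ _ e, integral_const_mul, (h _ _ _ _).2]
  rw [sum_mul_isotropicTensor (fun a b c e => Y b a * Z e c)]
  simp only [Matrix.trace, Matrix.diag, Matrix.mul_apply, Finset.sum_mul_sum,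
    Matrix.transpose_apply]
  rw [Finset.sum_comm (f := fun a b => Y b a * Z b a),
    Finset.sum_comm (f := fun a b => Y b a * Z a b)]

theorem trace_coeff [IsProbabilityMeasure μ] (h : HasIsotropicMoments μ X α β γ) {t : ℂ}
    (ht : ∀ g, (X g).trace = t) :
    (Fintype.card n : ℂ) ^ 2 * α + Fintype.card n * β + Fintype.card n * γ = t ^ 2 := by
  have := h.integral_trace_mul_trace 1 1
  simp [ht] at this
  linear_combination -this

theorem trace_sq_coeff [IsProbabilityMeasure μ] (h : HasIsotropicMoments μ X α β γ) {t : ℂ}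
    (ht : ∀ g, (X g * X g).trace = t) :
    Fintype.card n * α + Fintype.card n * β + (Fintype.card n : ℂ) ^ 2 * γ = t := by
  have h1 : ∫ g, (X g * X g).trace ∂μ = t := by simp [ht]
  simp only [Matrix.trace, Matrix.diag, Matrix.mul_apply] at h1
  rw [integral_finsetSum _ fun a _ => integrable_finsetSum _ fun b _ => (h a b b a).1] at h1
  simp_rw [integral_finsetSum _ fun b _ => (h _ b b _).1, (h _ _ _ _).2] at h1
  rw [← h1]
  simp only [isotropicTensor, Finset.sum_add_distrib, ← Finset.mul_sum]
  have h2 : ∀ a b : n, (a = b ∧ b = a) ↔ a = b := by grind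
  simp [h2]
  ring

end HasIsotropicMoments

section Conjugation

variable {G n : Type*} [Group G] [Fintype n] [DecidableEq n]

/-- The conjugation orbit map of a matrix under a matrix representation. -/
def conjOrbit (u : G →* Matrix n n ℂ) (M : Matrix n n ℂ) (g : G) : Matrix n n ℂ :=
  (u g)ᴴ * M * u g

theorem conjOrbit_mul (u : G →* Matrix n n ℂ) (M : Matrix n n ℂ) (g h : G) :
    conjOrbit u M (g * h) = (u h)ᴴ * conjOrbit u M g * u h := by
  simp only [conjOrbit, map_mul, Matrix.conjTranspose_mul, Matrix.mul_assoc]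

theorem conjOrbit_neg (u : G →* Matrix n n ℂ) (M : Matrix n n ℂ) (g : G) :
    conjOrbit u (-M) g = -conjOrbit u M g := by
  simp [conjOrbit]

theorem trace_conjOrbit {u : G →* Matrix n n ℂ} (hu : ∀ g, u g * (u g)ᴴ = 1) (M : Matrix n n ℂ)
    (g : G) : (conjOrbit u M g).trace = M.trace := by
  rw [conjOrbit, Matrix.mul_assoc, Matrix.trace_mul_comm, Matrix.mul_assoc, hu, Matrix.mul_one]

theorem conjOrbit_mul_conjOrbit {u : G →* Matrix n n ℂ} (hu : ∀ g, u g * (u g)ᴴ = 1)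
    (M N : Matrix n n ℂ) (g : G) : conjOrbit u M g * conjOrbit u N g = conjOrbit u (M * N) g := by
  simp only [conjOrbit, Matrix.mul_assoc]
  rw [← Matrix.mul_assoc (u g), hu, Matrix.one_mul]

variable [TopologicalSpace G]

theorem continuous_conjOrbit {u : G →* Matrix n n ℂ} (hu : Continuous u) (M : Matrix n n ℂ) :
    Continuous (conjOrbit u M) := by
  unfold conjOrbit
  fun_prop

variable [MeasurableSpace G] [BorelSpace G]

theorem integrable_conjOrbit_mul [CompactSpace G] (μ : Measure G) [IsProbabilityMeasure μ]
    {u : G →* Matrix n n ℂ} (hu : Continuous u) (M : Matrix n n ℂ) (a b c e : n) :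
    Integrable (fun g => conjOrbit u M g a b * conjOrbit u M g c e) μ := by
  have := continuous_conjOrbit hu M
  exact Continuous.integrable_of_hasCompactSupport (by fun_prop) (HasCompactSupport.of_compactSpace _)

theorem integral_conjOrbit_mul [IsTopologicalGroup G] [CompactSpace G] (μ : Measure G)
    [μ.IsHaarMeasure] [IsProbabilityMeasure μ] {u : G →* Matrix n n ℂ} (hu : Continuous u)
    (M : Matrix n n ℂ) (h : G) (a b c e : n) :
    ∫ g, conjOrbit u M g a b * conjOrbit u M g c e ∂μ =
      ∑ i, star (u h i a) * ∑ j, u h j b * ∑ k, star (u h k c) * ∑ l, u h l e *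
        ∫ g, conjOrbit u M g i j * conjOrbit u M g k l ∂μ := by
  have := isMulRightInvariant_of_compactSpace μ
  rw [← integral_mul_right_eq_self _ h]
  have hexp : ∀ g, conjOrbit u M (g * h) a b * conjOrbit u M (g * h) c e =
      ∑ i, star (u h i a) * ∑ j, u h j b * ∑ k, star (u h k c) * ∑ l, u h l e *
        (conjOrbit u M g i j * conjOrbit u M g k l) := by
    intro g
    have hentry : ∀ a b, conjOrbit u M (g * h) a b =
        ∑ i, ∑ j, star (u h i a) * (u h j b * conjOrbit u M g i j) := by
      intro a b
      rw [conjOrbit_mul, Matrix.mul_assoc, Matrix.mul_apply]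
      simp only [Matrix.mul_apply (N := u h), Matrix.conjTranspose_apply, Finset.mul_sum]
      simp only [mul_comm (u h _ b)]
    simp only [hentry, Finset.sum_mul]
    simp only [Finset.mul_sum]
    exact Finset.sum_congr rfl fun a _ => Finset.sum_congr rfl fun b _ =>
      Finset.sum_congr rfl fun c _ => Finset.sum_congr rfl fun e _ => by ring
  have hint := integrable_conjOrbit_mul μ hu M
  simp only [hexp]
  rw [integral_finsetSum _ fun i _ => (integrable_finsetSum _ fun j _ =>
    (integrable_finsetSum _ fun k _ => (integrable_finsetSum _ fun l _ =>
      (hint i j k l).const_mul _).const_mul _).const_mul _).const_mul _]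
  simp_rw [integral_const_mul]
  simp_rw [integral_finsetSum _ fun j _ => (integrable_finsetSum _ fun k _ =>
      (integrable_finsetSum _ fun l _ => (hint _ j k l).const_mul _).const_mul _).const_mul _,
    integral_const_mul, integral_finsetSum _ fun k _ =>
      (integrable_finsetSum _ fun l _ => (hint _ _ k l).const_mul _).const_mul _,
    integral_const_mul, integral_finsetSum _ fun l _ => (hint _ _ _ l).const_mul _,
    integral_const_mul]

theorem exists_hasIsotropicMoments [Nontrivial n] [IsTopologicalGroup G] [CompactSpace G]
    (μ : Measure G) [μ.IsHaarMeasure] [IsProbabilityMeasure μ] {u : G →* Matrix n n ℂ}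
    (hu : Continuous u)
    (hO : ∀ O ∈ Matrix.orthogonalGroup n ℝ, ∃ g, u g = O.map Complex.ofReal)
    (M : Matrix n n ℂ) : ∃ α β γ, HasIsotropicMoments μ (conjOrbit u M) α β γ := by
  have hT : IsOrthogonalInvariant fun a b c e =>
      ∫ g, conjOrbit u M g a b * conjOrbit u M g c e ∂μ := by
    intro O hO' a b c e
    obtain ⟨h, hh⟩ := hO O hO'
    simpa [hh] using integral_conjOrbit_mul μ hu M h a b c e
  obtain ⟨α, β, γ, hαβγ⟩ := hT.exists_eq_isotropicTensor
  exact ⟨α, β, γ, fun a b c e => ⟨integrable_conjOrbit_mul μ hu M a b c e,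
    congrFun (congrFun (congrFun (congrFun hαβγ a) b) c) e⟩⟩

theorem HasIsotropicMoments.eq_zero_of_phase [Nontrivial n] [IsTopologicalGroup G] [CompactSpace G]
    {μ : Measure G} [μ.IsHaarMeasure] [IsProbabilityMeasure μ] {u : G →* Matrix n n ℂ}
    (hu : Continuous u)
    (hU : ∀ v : n → ℂ, (∀ i, v i * star (v i) = 1) → ∃ g, u g = Matrix.diagonal v)
    {M : Matrix n n ℂ} {α β γ : ℂ} (h : HasIsotropicMoments μ (conjOrbit u M) α β γ) : β = 0 := by
  obtain ⟨x, y, hxy⟩ := exists_pair_ne n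
  obtain ⟨g, hg⟩ := hU (fun i => if i = x then Complex.I else 1) (by intro i; split_ifs <;> simp)
  have key : ∀ (F : n → ℂ) z, ∑ i, u g i z * F i = (if z = x then Complex.I else 1) * F z := by
    intro F z
    rw [hg, Finset.sum_eq_single z] <;> simp +contextual
  have key' : ∀ (F : n → ℂ) z, ∑ i, star (u g i z) * F i =
      star (if z = x then Complex.I else 1) * F z := by
    intro F z
    rw [hg, Finset.sum_eq_single z] <;> simp +contextual
  have h1 := integral_conjOrbit_mul μ hu M g x y x y
  simp only [key, key', (h _ _ _ _).2] at h1
  simp [isotropicTensor, hxy, hxy.symm] at h1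
  linear_combination h1 / 2 + β / 2 * Complex.I_mul_I

end Conjugation

section CoefficientValues

variable {Ω n : Type*} [Fintype n] [DecidableEq n] [Nontrivial n] [MeasurableSpace Ω]
  {μ : Measure Ω} [IsProbabilityMeasure μ] {X : Ω → Matrix n n ℂ} {α β γ : ℂ} {d : ℕ}

theorem HasIsotropicMoments.coeffs_of_symm (h : HasIsotropicMoments μ X α β γ)
    (hd : Fintype.card n = d) (hX : ∀ g, (X g)ᵀ = X g) (h0 : ∀ g, (X g).trace = 0)
    (h2 : ∀ g, (X g * X g).trace = d) :
    (((d : ℂ) - 1) * (d + 2) / 2) * α = -1 ∧ (((d : ℂ) - 1) * (d + 2) / 2) * β = d / 2 ∧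
      (((d : ℂ) - 1) * (d + 2) / 2) * γ = d / 2 := by
  have hd0 : (d : ℂ) ≠ 0 := by rw [← hd]; exact_mod_cast Fintype.card_ne_zero
  have e1 := h.trace_coeff h0
  have e2 := h.trace_sq_coeff h2
  obtain rfl := h.eq_of_symm hX
  rw [hd] at e1 e2
  have e1' : (d : ℂ) * α + 2 * β = 0 := mul_left_cancel₀ hd0 (by linear_combination e1)
  have e2' : α + β + d * β = 1 := mul_left_cancel₀ hd0 (by linear_combination e2)
  have e3 : (((d : ℂ) - 1) * (d + 2) / 2) * β = d / 2 := by
    linear_combination d / 2 * e2' - e1' / 2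
  refine ⟨mul_left_cancel₀ hd0 ?_, e3, e3⟩
  linear_combination (((d : ℂ) - 1) * (d + 2) / 2) * e1' - 2 * e3

theorem HasIsotropicMoments.coeffs_of_antisymm (h : HasIsotropicMoments μ X α β γ)
    (hd : Fintype.card n = d) (hX : ∀ g, (X g)ᵀ = -X g) (h2 : ∀ g, (X g * X g).trace = d) :
    α = 0 ∧ ((d : ℂ) * (d - 1) / 2) * β = -(d / 2) ∧ ((d : ℂ) * (d - 1) / 2) * γ = d / 2 := by
  have e2 := h.trace_sq_coeff h2
  obtain ⟨rfl, rfl⟩ := h.eq_of_antisymm hX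
  rw [hd] at e2
  refine ⟨rfl, ?_, ?_⟩
  · linear_combination -e2 / 2
  · linear_combination e2 / 2

theorem HasIsotropicMoments.coeffs_of_eq_zero (h : HasIsotropicMoments μ X α β γ)
    (hd : Fintype.card n = d) (hβ : β = 0) (h0 : ∀ g, (X g).trace = 0)
    (h2 : ∀ g, (X g * X g).trace = d) :
    ((d : ℂ) ^ 2 - 1) * α = -1 ∧ ((d : ℂ) ^ 2 - 1) * γ = d := by
  have hd0 : (d : ℂ) ≠ 0 := by rw [← hd]; exact_mod_cast Fintype.card_ne_zero
  have e1 := h.trace_coeff h0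
  have e2 := h.trace_sq_coeff h2
  subst hβ
  rw [hd] at e1 e2
  have e1' : (d : ℂ) * α + γ = 0 := mul_left_cancel₀ hd0 (by linear_combination e1)
  have e2' : α + d * γ = 1 := mul_left_cancel₀ hd0 (by linear_combination e2)
  constructor
  · linear_combination d * e1' - e2'
  · linear_combination d * e2' - e1'

end CoefficientValues

section Bipartite

variable {d : ℕ}

/-- The `(k, k')` block of a bipartite matrix with respect to the second factor. -/
def blockB (ρ : Matrix (Fin d × Fin d) (Fin d × Fin d) ℂ) (k k' : Fin d) :
    Matrix (Fin d) (Fin d) ℂ :=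
  Matrix.of fun j j' => ρ (j, k) (j', k')

theorem sum_blockB (ρ : Matrix (Fin d × Fin d) (Fin d × Fin d) ℂ) :
    ∑ k, blockB ρ k k = redA ρ := by
  ext j j'
  simp [Matrix.sum_apply, blockB, redA]

theorem trace_blockB (ρ : Matrix (Fin d × Fin d) (Fin d × Fin d) ℂ) (k k' : Fin d) :
    (blockB ρ k k').trace = redB ρ k k' := by
  simp [Matrix.trace, blockB, redB]

theorem trace_redA (ρ : Matrix (Fin d × Fin d) (Fin d × Fin d) ℂ) :
    (redA ρ).trace = ρ.trace := by
  simp [Matrix.trace, redA, Fintype.sum_prod_type]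

theorem redA_isHermitian {ρ : Matrix (Fin d × Fin d) (Fin d × Fin d) ℂ} (hρ : ρ.IsHermitian) :
    (redA ρ).IsHermitian := by
  ext j j'
  simp only [redA, Matrix.conjTranspose_apply, Matrix.of_apply, star_sum, hρ.apply]

theorem redB_isHermitian {ρ : Matrix (Fin d × Fin d) (Fin d × Fin d) ℂ} (hρ : ρ.IsHermitian) :
    (redB ρ).IsHermitian := by
  ext j j'
  simp only [redB, Matrix.conjTranspose_apply, Matrix.of_apply, star_sum, hρ.apply]

/-- The partial contraction of a bipartite matrix against a matrix on the first factor. -/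
def contractA (ρ : Matrix (Fin d × Fin d) (Fin d × Fin d) ℂ) (X : Matrix (Fin d) (Fin d) ℂ) :
    Matrix (Fin d) (Fin d) ℂ :=
  Matrix.of fun k k' => (blockB ρ k k' * X).trace

theorem sum_sum_sum_sum_comm (F : Fin d → Fin d → Fin d → Fin d → ℂ) :
    ∑ j, ∑ k, ∑ j', ∑ k', F j k j' k' = ∑ k, ∑ k', ∑ j, ∑ j', F j k j' k' := by
  rw [Finset.sum_comm]
  refine Finset.sum_congr rfl fun k _ => ?_
  rw [Finset.sum_comm (f := fun k' j => ∑ j', F j k j' k')]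
  exact Finset.sum_congr rfl fun j _ => Finset.sum_comm

theorem trace_mul_kronecker (ρ : Matrix (Fin d × Fin d) (Fin d × Fin d) ℂ)
    (X Y : Matrix (Fin d) (Fin d) ℂ) : (ρ * (X ⊗ₖ Y)).trace = (contractA ρ X * Y).trace := by
  simp only [Matrix.trace, Matrix.diag, Matrix.mul_apply, contractA, blockB, Matrix.of_apply,
    Fintype.sum_prod_type, Matrix.kroneckerMap_apply, Finset.sum_mul]
  rw [sum_sum_sum_sum_comm]
  simp only [mul_assoc]

theorem trace_contractA (ρ : Matrix (Fin d × Fin d) (Fin d × Fin d) ℂ)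
    (X : Matrix (Fin d) (Fin d) ℂ) : (contractA ρ X).trace = (redA ρ * X).trace := by
  rw [← sum_blockB, Finset.sum_mul, Matrix.trace_sum]
  rfl

/-- The second moment of a bipartite matrix whose two factors are contracted against random
matrices with isotropic moments. -/
noncomputable def bipartiteMoment (ρ : Matrix (Fin d × Fin d) (Fin d × Fin d) ℂ)
    (α β γ α' β' γ' : ℂ) : ℂ :=
  α' * (α * (ρ.trace * ρ.trace) + β * (redA ρ * (redA ρ)ᵀ).trace + γ * (redA ρ * redA ρ).trace) +
  β' * (α * (redB ρ * (redB ρ)ᵀ).trace + β * (ρ * ρᵀ).trace +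
    γ * ∑ k, ∑ k', (blockB ρ k k' * blockB ρ k k').trace) +
  γ' * (α * (redB ρ * redB ρ).trace +
    β * ∑ k, ∑ k', (blockB ρ k k' * (blockB ρ k' k)ᵀ).trace + γ * (ρ * ρ).trace)

theorem bipartiteMoment_mul (ρ : Matrix (Fin d × Fin d) (Fin d × Fin d) ℂ)
    (s t α β γ α' β' γ' : ℂ) : s * t * bipartiteMoment ρ α β γ α' β' γ' =
      bipartiteMoment ρ (s * α) (s * β) (s * γ) (t * α') (t * β') (t * γ') := by
  unfold bipartiteMoment
  ring

theorem sum_trace_blockB_mul_transpose (ρ : Matrix (Fin d × Fin d) (Fin d × Fin d) ℂ) :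
    ∑ k, ∑ k', (blockB ρ k k' * (blockB ρ k k')ᵀ).trace = (ρ * ρᵀ).trace := by
  simp only [Matrix.trace, Matrix.diag, Matrix.mul_apply, blockB, Matrix.of_apply,
    Fintype.sum_prod_type, Matrix.transpose_apply]
  exact (sum_sum_sum_sum_comm fun j k j' k' => ρ (j, k) (j', k') * ρ (j, k) (j', k')).symm

theorem sum_trace_blockB_mul (ρ : Matrix (Fin d × Fin d) (Fin d × Fin d) ℂ) :
    ∑ k, ∑ k', (blockB ρ k k' * blockB ρ k' k).trace = (ρ * ρ).trace := by
  simp only [Matrix.trace, Matrix.diag, Matrix.mul_apply, blockB, Matrix.of_apply,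
    Fintype.sum_prod_type]
  exact (sum_sum_sum_sum_comm fun j k j' k' => ρ (j, k) (j', k') * ρ (j', k') (j, k)).symm

theorem integral_integral_trace_sq {Ω Ω' : Type*} [MeasurableSpace Ω] [MeasurableSpace Ω']
    {μ : Measure Ω} {ν : Measure Ω'} {X : Ω → Matrix (Fin d) (Fin d) ℂ}
    {Y : Ω' → Matrix (Fin d) (Fin d) ℂ} {α β γ α' β' γ' : ℂ}
    (hX : HasIsotropicMoments μ X α β γ) (hY : HasIsotropicMoments ν Y α' β' γ')
    (ρ : Matrix (Fin d × Fin d) (Fin d × Fin d) ℂ) :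
    ∫ g, ∫ h, (ρ * (X g ⊗ₖ Y h)).trace ^ 2 ∂ν ∂μ = bipartiteMoment ρ α β γ α' β' γ' := by
  have hinner : ∀ g, ∫ h, (ρ * (X g ⊗ₖ Y h)).trace ^ 2 ∂ν =
      α' * ((redA ρ * X g).trace * (redA ρ * X g).trace) +
      β' * ∑ k, ∑ k', (blockB ρ k k' * X g).trace * (blockB ρ k k' * X g).trace +
      γ' * ∑ k, ∑ k', (blockB ρ k k' * X g).trace * (blockB ρ k' k * X g).trace := by
    intro g
    simp only [trace_mul_kronecker, pow_two]
    rw [hY.integral_trace_mul_trace, trace_contractA]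
    rfl
  have hint := fun k k' l l' => hX.integrable_trace_mul_trace (blockB ρ k k') (blockB ρ l l')
  simp only [hinner]
  rw [integral_add, integral_add, integral_const_mul, integral_const_mul, integral_const_mul,
    integral_finsetSum _ fun k _ => integrable_finsetSum _ fun k' _ => hint _ _ _ _,
    integral_finsetSum _ fun k _ => integrable_finsetSum _ fun k' _ => hint _ _ _ _]
  · simp_rw [integral_finsetSum _ fun k' _ => hint _ _ _ _, hX.integral_trace_mul_trace,
      Finset.sum_add_distrib, ← Finset.mul_sum, sum_trace_blockB_mul_transpose,
      sum_trace_blockB_mul, trace_blockB, trace_redA]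
    rfl
  · exact (hX.integrable_trace_mul_trace _ _).const_mul _
  · exact (integrable_finsetSum _ fun k _ => integrable_finsetSum _ fun k' _ =>
      hint _ _ _ _).const_mul _
  · exact ((hX.integrable_trace_mul_trace _ _).const_mul _).add
      ((integrable_finsetSum _ fun k _ => integrable_finsetSum _ fun k' _ =>
        hint _ _ _ _).const_mul _)
  · exact (integrable_finsetSum _ fun k _ => integrable_finsetSum _ fun k' _ =>
      hint _ _ _ _).const_mul _

theorem ofReal_re_trace_mul {n : Type*} [Fintype n] {A B : Matrix n n ℂ} (hA : A.IsHermitian)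
    (hB : B.IsHermitian) : (((A * B).trace.re : ℝ) : ℂ) = (A * B).trace := by
  rw [← Complex.conj_eq_iff_re, starRingEnd_apply, ← Matrix.trace_conjTranspose,
    Matrix.conjTranspose_mul, hA.eq, hB.eq, Matrix.trace_mul_comm]

theorem ofReal_integral_integral_re_trace_sq {G : Type*} [Group G] [MeasurableSpace G]
    {μ : Measure G} {u : G →* Matrix (Fin d) (Fin d) ℂ} {M N : Matrix (Fin d) (Fin d) ℂ}
    (hM : M.IsHermitian) (hN : N.IsHermitian) {α β γ α' β' γ' : ℂ}
    (hX : HasIsotropicMoments μ (conjOrbit u M) α β γ)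
    (hY : HasIsotropicMoments μ (conjOrbit u N) α' β' γ')
    {ρ : Matrix (Fin d × Fin d) (Fin d × Fin d) ℂ} (hρ : ρ.IsHermitian) :
    ((∫ g, ∫ h, (((u g ⊗ₖ u h) * ρ * ((u g)ᴴ ⊗ₖ (u h)ᴴ) * (M ⊗ₖ N)).trace.re) ^ 2 ∂μ ∂μ : ℝ) : ℂ)
      = bipartiteMoment ρ α β γ α' β' γ' := by
  rw [← integral_integral_trace_sq hX hY, ← integral_complex_ofReal]
  congr 1 with g
  rw [← integral_complex_ofReal]
  congr 1 with h
  have htr : ((u g ⊗ₖ u h) * ρ * ((u g)ᴴ ⊗ₖ (u h)ᴴ) * (M ⊗ₖ N)).trace =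
      (ρ * (conjOrbit u M g ⊗ₖ conjOrbit u N h)).trace := by
    rw [conjOrbit, conjOrbit, Matrix.mul_kronecker_mul, Matrix.mul_kronecker_mul,
      Matrix.mul_assoc, Matrix.mul_assoc, Matrix.trace_mul_comm]
    simp only [Matrix.mul_assoc]
  have hK : (conjOrbit u M g ⊗ₖ conjOrbit u N h).IsHermitian := by
    rw [Matrix.IsHermitian, Matrix.conjTranspose_kronecker]
    congr 1
    · exact Matrix.isHermitian_conjTranspose_mul_mul _ hM
    · exact Matrix.isHermitian_conjTranspose_mul_mul _ hN
  rw [htr, Complex.ofReal_pow, ofReal_re_trace_mul hρ hK]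

theorem ofReal_fro2_sub_transpose {n : Type*} [Fintype n] {H : Matrix n n ℂ} (hH : H.IsHermitian) :
    (fro2 (H - Hᵀ) : ℂ) = 2 * (H * H).trace - 2 * (H * Hᵀ).trace := by
  have hD : (H - Hᵀ).IsHermitian := hH.sub hH.transpose
  rw [fro2, hD.eq, ofReal_re_trace_mul hD hD]
  simp only [Matrix.sub_mul, Matrix.mul_sub, Matrix.trace_sub]
  rw [← Matrix.transpose_mul, Matrix.trace_transpose, Matrix.trace_mul_comm Hᵀ H]
  ring

end Bipartite

theorem conjOrbit_transpose {G : Type*} [Group G] {d : ℕ} {u : G →* Matrix (Fin d) (Fin d) ℂ}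
    (hu : ∀ g, (u g)ᴴ = (u g)ᵀ) (M : Matrix (Fin d) (Fin d) ℂ) (g : G) :
    (conjOrbit u M g)ᵀ = conjOrbit u Mᵀ g := by
  simp only [conjOrbit, hu, Matrix.transpose_mul, Matrix.transpose_transpose, Matrix.mul_assoc]

/-- The defining representation of the orthogonal group on complex matrices. -/
noncomputable def orthogonalRep (d : ℕ) :
    Matrix.orthogonalGroup (Fin d) ℝ →* Matrix (Fin d) (Fin d) ℂ :=
  (Complex.ofRealHom.mapMatrix : Matrix (Fin d) (Fin d) ℝ →+* Matrix (Fin d) (Fin d) ℂ).toMonoidHom.comp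
    (Matrix.orthogonalGroup (Fin d) ℝ).subtype

theorem orthogonalRep_apply {d : ℕ} (O : Matrix.orthogonalGroup (Fin d) ℝ) :
    orthogonalRep d O = OC O :=
  rfl

theorem continuous_orthogonalRep (d : ℕ) : Continuous (orthogonalRep d) :=
  continuous_subtype_val.matrix_map Complex.continuous_ofReal

theorem conjTranspose_orthogonalRep {d : ℕ} (O : Matrix.orthogonalGroup (Fin d) ℝ) :
    (orthogonalRep d O)ᴴ = (orthogonalRep d O)ᵀ := by
  ext i j
  simp [orthogonalRep_apply, OC]

theorem orthogonalRep_mul_conjTranspose {d : ℕ} (O : Matrix.orthogonalGroup (Fin d) ℝ) :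
    orthogonalRep d O * (orthogonalRep d O)ᴴ = 1 := by
  have h : (O : Matrix (Fin d) (Fin d) ℝ) * (O : Matrix (Fin d) (Fin d) ℝ)ᵀ = 1 :=
    (Matrix.mem_orthogonalGroup_iff _ _).1 O.2
  rw [conjTranspose_orthogonalRep]
  have := congrArg (Complex.ofRealHom.mapMatrix : Matrix (Fin d) (Fin d) ℝ →+* _) h
  rwa [map_mul, map_one] at this

/-- the Frobenius-norm identity relating `‖ρ − ρᵀ‖_F²` to the moments
`R`, `Q`, `Q̂` and the reduced states. -/
theorem stmt_8 (d : ℕ) (hd : 2 ≤ d)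
    [MeasurableSpace (Matrix.orthogonalGroup (Fin d) ℝ)]
    [BorelSpace (Matrix.orthogonalGroup (Fin d) ℝ)]
    (μO : Measure (Matrix.orthogonalGroup (Fin d) ℝ))
    [μO.IsHaarMeasure] [IsProbabilityMeasure μO]
    [MeasurableSpace (Matrix.unitaryGroup (Fin d) ℂ)]
    [BorelSpace (Matrix.unitaryGroup (Fin d) ℂ)]
    (μU : Measure (Matrix.unitaryGroup (Fin d) ℂ))
    [μU.IsHaarMeasure] [IsProbabilityMeasure μU]
    (ρ : Matrix (Fin d × Fin d) (Fin d × Fin d) ℂ) (hρ : ρ.IsHermitian) (hρtr : ρ.trace = 1)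
    (NA NB : Matrix (Fin d) (Fin d) ℂ) (hNA : NA.IsHermitian) (hNB : NB.IsHermitian)
    (hNAtr : NA.trace = 0) (hNBtr : NB.trace = 0)
    (hNA2 : (NA * NA).trace = (d : ℂ)) (hNB2 : (NB * NB).trace = (d : ℂ))
    (MA MB : Matrix (Fin d) (Fin d) ℂ) (hMA : MA.IsHermitian) (hMB : MB.IsHermitian)
    (hMAreal : MAᵀ = MA) (hMBreal : MBᵀ = MB)
    (hMAtr : MA.trace = 0) (hMBtr : MB.trace = 0)
    (hMA2 : (MA * MA).trace = (d : ℂ)) (hMB2 : (MB * MB).trace = (d : ℂ))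
    (MhA MhB : Matrix (Fin d) (Fin d) ℂ) (hMhA : MhA.IsHermitian) (hMhB : MhB.IsHermitian)
    (hMhAimag : MhAᵀ = -MhA) (hMhBimag : MhBᵀ = -MhB)
    (hMhA2 : (MhA * MhA).trace = (d : ℂ)) (hMhB2 : (MhB * MhB).trace = (d : ℂ))
    (R Q Qh : ℝ)
    (hR : R = ∫ UA, ∫ UB,
      ((((UA : Matrix (Fin d) (Fin d) ℂ) ⊗ₖ (UB : Matrix (Fin d) (Fin d) ℂ)) * ρ *
        ((UA : Matrix (Fin d) (Fin d) ℂ) ⊗ₖ (UB : Matrix (Fin d) (Fin d) ℂ))ᴴ *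
        (NA ⊗ₖ NB)).trace.re) ^ 2 ∂μU ∂μU)
    (hQ : Q = ∫ OA, ∫ OB,
      (((OC OA ⊗ₖ OC OB) * ρ * ((OC OA)ᵀ ⊗ₖ (OC OB)ᵀ) * (MA ⊗ₖ MB)).trace.re) ^ 2 ∂μO ∂μO)
    (hQh : Qh = ∫ OA, ∫ OB,
      (((OC OA ⊗ₖ OC OB) * ρ * ((OC OA)ᵀ ⊗ₖ (OC OB)ᵀ) * (MhA ⊗ₖ MhB)).trace.re) ^ 2 ∂μO ∂μO) :
    fro2 (ρ - ρᵀ) =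
      (1 / (d : ℝ)) * (fro2 (redA ρ - (redA ρ)ᵀ) + fro2 (redB ρ - (redB ρ)ᵀ)) +
        (4 / (d : ℝ) ^ 2) *
          (((d : ℝ) ^ 2 - 1) ^ 2 * R -
            (((d : ℝ) - 1) * ((d : ℝ) + 2) / 2) ^ 2 * Q -
            ((d : ℝ) * ((d : ℝ) - 1) / 2) ^ 2 * Qh) := by
  have : Nontrivial (Fin d) := Fin.nontrivial_iff_two_le.2 hd
  have : CompactSpace (Matrix.orthogonalGroup (Fin d) ℝ) :=
    isCompact_iff_compactSpace.1 (isCompact_unitaryGroup (Fin d) ℝ)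
  have : CompactSpace (Matrix.unitaryGroup (Fin d) ℂ) :=
    isCompact_iff_compactSpace.1 (isCompact_unitaryGroup (Fin d) ℂ)
  have hcard : Fintype.card (Fin d) = d := Fintype.card_fin d
  have hd' : (2 : ℝ) ≤ d := by exact_mod_cast hd
  have hd0 : (d : ℂ) ≠ 0 := by exact_mod_cast (by linarith : (d : ℝ) ≠ 0)
  have hK : ((d : ℂ) ^ 2 - 1) ^ 2 * R = bipartiteMoment ρ (-1) 0 d (-1) 0 d := by
    let u := (Matrix.unitaryGroup (Fin d) ℂ).subtype
    have hu : Continuous u := continuous_subtype_val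
    have huu : ∀ g, u g * (u g)ᴴ = 1 := fun g => (Matrix.mem_unitaryGroup_iff).1 g.2
    have hO : ∀ O ∈ Matrix.orthogonalGroup (Fin d) ℝ, ∃ g, u g = O.map Complex.ofReal :=
      fun O hO => ⟨⟨orthogonalRep d ⟨O, hO⟩, Matrix.mem_unitaryGroup_iff.2
        (orthogonalRep_mul_conjTranspose ⟨O, hO⟩)⟩, rfl⟩
    have hV : ∀ v : Fin d → ℂ, (∀ i, v i * star (v i) = 1) → ∃ g, u g = Matrix.diagonal v := by
      intro v hv
      refine ⟨⟨Matrix.diagonal v, Matrix.mem_unitaryGroup_iff.2 ?_⟩, rfl⟩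
      rw [Matrix.star_eq_conjTranspose, Matrix.diagonal_conjTranspose, Matrix.diagonal_mul_diagonal]
      exact (congrArg Matrix.diagonal (funext hv)).trans Matrix.diagonal_one
    obtain ⟨α, β, γ, hX⟩ := exists_hasIsotropicMoments μU hu hO NA
    obtain ⟨α', β', γ', hY⟩ := exists_hasIsotropicMoments μU hu hO NB
    have hR' := ofReal_integral_integral_re_trace_sq hNA hNB hX hY hρ
    simp only [← Matrix.conjTranspose_kronecker] at hR'
    have hβ := hX.eq_zero_of_phase hu hV
    have hβ' := hY.eq_zero_of_phase hu hV
    obtain ⟨h1, h2⟩ := hX.coeffs_of_eq_zero hcard hβ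
      (fun g => (trace_conjOrbit huu NA g).trans hNAtr)
      (fun g => by rw [conjOrbit_mul_conjOrbit huu, trace_conjOrbit huu, hNA2])
    obtain ⟨h1', h2'⟩ := hY.coeffs_of_eq_zero hcard hβ'
      (fun g => (trace_conjOrbit huu NB g).trans hNBtr)
      (fun g => by rw [conjOrbit_mul_conjOrbit huu, trace_conjOrbit huu, hNB2])
    rw [hR]
    refine (congrArg _ hR').trans ?_
    rw [pow_two, bipartiteMoment_mul, h1, h2, h1', h2', hβ, hβ', mul_zero]
  have hu := continuous_orthogonalRep d
  have huu := orthogonalRep_mul_conjTranspose (d := d)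
  have hut := conjTranspose_orthogonalRep (d := d)
  have hO : ∀ O ∈ Matrix.orthogonalGroup (Fin d) ℝ, ∃ g,
      orthogonalRep d g = O.map Complex.ofReal := fun O hO => ⟨⟨O, hO⟩, rfl⟩
  have hL : (((d : ℂ) - 1) * (d + 2) / 2) ^ 2 * Q =
      bipartiteMoment ρ (-1) (d / 2) (d / 2) (-1) (d / 2) (d / 2) := by
    obtain ⟨α, β, γ, hX⟩ := exists_hasIsotropicMoments μO hu hO MA
    obtain ⟨α', β', γ', hY⟩ := exists_hasIsotropicMoments μO hu hO MB
    have hQ' := ofReal_integral_integral_re_trace_sq hMA hMB hX hY hρ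
    simp only [hut] at hQ'
    obtain ⟨h1, h2, h3⟩ := hX.coeffs_of_symm hcard
      (fun g => by rw [conjOrbit_transpose hut, hMAreal])
      (fun g => (trace_conjOrbit huu MA g).trans hMAtr)
      (fun g => by rw [conjOrbit_mul_conjOrbit huu, trace_conjOrbit huu, hMA2])
    obtain ⟨h1', h2', h3'⟩ := hY.coeffs_of_symm hcard
      (fun g => by rw [conjOrbit_transpose hut, hMBreal])
      (fun g => (trace_conjOrbit huu MB g).trans hMBtr)
      (fun g => by rw [conjOrbit_mul_conjOrbit huu, trace_conjOrbit huu, hMB2])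
    rw [hQ]
    refine (congrArg _ hQ').trans ?_
    rw [pow_two, bipartiteMoment_mul, h1, h2, h3, h1', h2', h3']
  have hLh : ((d : ℂ) * (d - 1) / 2) ^ 2 * Qh =
      bipartiteMoment ρ 0 (-(d / 2)) (d / 2) 0 (-(d / 2)) (d / 2) := by
    obtain ⟨α, β, γ, hX⟩ := exists_hasIsotropicMoments μO hu hO MhA
    obtain ⟨α', β', γ', hY⟩ := exists_hasIsotropicMoments μO hu hO MhB
    have hQ' := ofReal_integral_integral_re_trace_sq hMhA hMhB hX hY hρ
    simp only [hut] at hQ'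
    obtain ⟨h1, h2, h3⟩ := hX.coeffs_of_antisymm hcard
      (fun g => by rw [conjOrbit_transpose hut, hMhAimag, conjOrbit_neg])
      (fun g => by rw [conjOrbit_mul_conjOrbit huu, trace_conjOrbit huu, hMhA2])
    obtain ⟨h1', h2', h3'⟩ := hY.coeffs_of_antisymm hcard
      (fun g => by rw [conjOrbit_transpose hut, hMhBimag, conjOrbit_neg])
      (fun g => by rw [conjOrbit_mul_conjOrbit huu, trace_conjOrbit huu, hMhB2])
    rw [hQh]
    refine (congrArg _ hQ').trans ?_
    rw [pow_two, bipartiteMoment_mul, h1, h2, h3, h1', h2', h3', mul_zero]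
  apply Complex.ofReal_injective
  push_cast
  rw [ofReal_fro2_sub_transpose hρ, ofReal_fro2_sub_transpose (redA_isHermitian hρ),
    ofReal_fro2_sub_transpose (redB_isHermitian hρ), hK, hL, hLh]
  simp only [bipartiteMoment, hρtr]
  field_simp
  ring
end
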